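/- Fix θ = (σ,δ,α) with σ > 0, δ > 0, α ∈ (0,2). There exist C > 0 and N ∈ ℕ such that for all n ≥ N: | ∫_ℝ (h_α(y, w_n(θ))² / f_α(y, w_n(θ))) dy − α² κ₀(θ) / (n^{1−α/2} (ln n)^{α/2}) | ≤ C (1/(n^{1−α/2} (ln n)^{α/2})) · ln(ln n)/(ln n)^{min(1/4, α)}. -/

import Mathlib

open MeasureTheory Filter Set Topology Matrix

noncomputable section

namespace LevyLAN

/-- Standard Gaussian density `φ`. -/
def gauss (y : ℝ) : ℝ := (Real.sqrt (2 * Real.pi))⁻¹ * Real.exp (-(y ^ 2) / 2)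

/-- Symmetric `α`-stable density `φ_α`, defined by Fourier inversion. -/
def stableDensity (α z : ℝ) : ℝ :=
  (2 * Real.pi)⁻¹ * ∫ u : ℝ, Real.cos (z * u) * Real.exp (-(|u| ^ α))

/-- `∂_α φ_α`. -/
def stableDensityDalpha (α z : ℝ) : ℝ :=
  -(2 * Real.pi)⁻¹ * ∫ u : ℝ, Real.cos (z * u) * |u| ^ α * Real.log |u| * Real.exp (-(|u| ^ α))

/-- The operator `(D f) y = (y * f y)' = f y + y * f' y`. -/
def Dop (f : ℝ → ℝ) (y : ℝ) : ℝ := f y + y * deriv f y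

/-- `f_α(y, w)`. -/
def fFun (α y w : ℝ) : ℝ := ∫ z : ℝ, gauss (y - w * z) * stableDensity α z

/-- `g_α(y, w)`. -/
def gFun (α y w : ℝ) : ℝ := ∫ z : ℝ, Dop gauss (y - w * z) * stableDensity α z

/-- `h_α(y, w)`. -/
def hFun (α y w : ℝ) : ℝ := ∫ z : ℝ, gauss (y - w * z) * Dop (stableDensity α) z

/-- `k_α(y, w)`. -/
def kFun (α y w : ℝ) : ℝ := ∫ z : ℝ, gauss (y - w * z) * stableDensityDalpha α z

/-- `c_α`. -/
def cAlpha (α : ℝ) : ℝ :=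
  if α = 1 then 1 / Real.pi
  else -(α * (α - 1)) / (2 * Real.Gamma (2 - α) * Real.cos (Real.pi * α / 2))

/-- `w_n(θ) = n^{1/2 - 1/α} δ / σ`. -/
def wn (n : ℕ) (σ δ α : ℝ) : ℝ := (n : ℝ) ^ ((1 : ℝ) / 2 - 1 / α) * δ / σ

/-- `l_α(y, w)` (it depends on `n`). -/
def lFun (n : ℕ) (α y w : ℝ) : ℝ :=
  ((Real.log n - Real.log (Real.log n)) / (2 * α) - Real.log n / α ^ 2) * hFun α y w
    + kFun α y w

def kappa0 (σ δ α : ℝ) : ℝ := 2 * cAlpha α / (α * (2 - α) ^ (α / 2)) * (δ / σ) ^ α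

def kappa1 (σ δ α : ℝ) : ℝ :=
  Real.log (δ / σ) + deriv cAlpha α / cAlpha α - Real.log (2 - α) / 2 - 1 / α

/-- The density `p_{1/n}(y, θ)`, with parameter `θ = (σ, δ, α) : Fin 3 → ℝ`. -/
def pdens (n : ℕ) (θ : Fin 3 → ℝ) (y : ℝ) : ℝ :=
  Real.sqrt n / θ 0 * fFun (θ 2) (Real.sqrt n * y / θ 0) (wn n (θ 0) (θ 1) (θ 2))

/-- The log-likelihood `ln L_n(θ)`. -/
def logLik (n : ℕ) (θ : Fin 3 → ℝ) (x : Fin n → ℝ) : ℝ :=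
  ∑ i, Real.log (pdens n θ (x i))

/-- Partial derivative in the `j`-th parameter coordinate. -/
def pderiv (j : Fin 3) (F : (Fin 3 → ℝ) → ℝ) (θ : Fin 3 → ℝ) : ℝ :=
  deriv (fun t => F (Function.update θ j t)) (θ j)

/-- The score `G_n(θ) = ∇_θ ln L_n(θ)`. -/
def scoreVec (n : ℕ) (θ : Fin 3 → ℝ) (x : Fin n → ℝ) : Fin 3 → ℝ :=
  fun j => pderiv j (fun θ' => logLik n θ' x) θ

/-- The Hessian matrix `J_n(θ)` of the log-likelihood. -/
def hessMat (n : ℕ) (θ : Fin 3 → ℝ) (x : Fin n → ℝ) : Matrix (Fin 3) (Fin 3) ℝ :=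
  Matrix.of fun i j => pderiv i (fun θ' => pderiv j (fun θ'' => logLik n θ'' x) θ') θ

def rate (n : ℕ) (α : ℝ) : ℝ := Real.log n ^ (α / 4) / (n : ℝ) ^ (α / 4)

/-- The rate matrix `u_n(θ)`. -/
def un (n : ℕ) (θ : Fin 3 → ℝ) : Matrix (Fin 3) (Fin 3) ℝ :=
  !![1 / Real.sqrt n, 0, 0;
     0, rate n (θ 2), -(rate n (θ 2) * (θ 1 / (2 * θ 2)) * (Real.log n - Real.log (Real.log n)));
     0, 0, rate n (θ 2)]

/-- The information matrix `I(θ)`. -/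
def Imat (θ : Fin 3 → ℝ) : Matrix (Fin 3) (Fin 3) ℝ :=
  !![2 / θ 0 ^ 2, 0, 0;
     0, θ 2 ^ 2 / θ 1 ^ 2 * kappa0 (θ 0) (θ 1) (θ 2),
        θ 2 / θ 1 * kappa0 (θ 0) (θ 1) (θ 2) * kappa1 (θ 0) (θ 1) (θ 2);
     0, θ 2 / θ 1 * kappa0 (θ 0) (θ 1) (θ 2) * kappa1 (θ 0) (θ 1) (θ 2),
        kappa0 (θ 0) (θ 1) (θ 2) * (kappa1 (θ 0) (θ 1) (θ 2) ^ 2 + 1 / θ 2 ^ 2)]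

/-- `ℙ_n`, the `n`-fold product of the law with Lebesgue density `p_{1/n}(·, θ)`. -/
def Pn (n : ℕ) (θ : Fin 3 → ℝ) : Measure (Fin n → ℝ) :=
  Measure.pi fun _ => MeasureTheory.volume.withDensity fun y => ENNReal.ofReal (pdens n θ y)

/-- The standard Gaussian measure on `ℝ³`. -/
def stdGauss3 : Measure (Fin 3 → ℝ) :=
  Measure.pi fun _ => ProbabilityTheory.gaussianReal 0 1

/-- Euclidean (Frobenius) norm of a real 3×3 matrix. -/
def frobNorm (M : Matrix (Fin 3) (Fin 3) ℝ) : ℝ := Real.sqrt (∑ i, ∑ j, M i j ^ 2)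

/-- Euclidean norm of a vector of `ℝ³`. -/
def vecNorm (v : Fin 3 → ℝ) : ℝ := Real.sqrt (∑ j, v j ^ 2)

/-- The admissible families of functions `ψ_α^{(p)}`. -/
structure IsPsiFamily (ψ : ℝ → ℕ → ℝ → ℝ) : Prop where
  contDiff : ∀ α ∈ Set.Ioo (0 : ℝ) 2, ∀ p : ℕ, ContDiff ℝ 2 (ψ α p)
  pos : ∀ α ∈ Set.Ioo (0 : ℝ) 2, ∀ p : ℕ, ∀ y : ℝ, 0 < ψ α p y
  even : ∀ α ∈ Set.Ioo (0 : ℝ) 2, ∀ p : ℕ, ∀ y : ℝ, ψ α p (-y) = ψ α p y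
  eq_one : ∀ α ∈ Set.Ioo (0 : ℝ) 2, ∀ p : ℕ, ∀ y : ℝ, |y| ≤ 1 → ψ α p y = 1
  eq_tail : ∀ α ∈ Set.Ioo (0 : ℝ) 2, ∀ p : ℕ, ∀ y : ℝ, 3 ≤ |y| →
    ψ α p y = Real.log |y| ^ p / |y| ^ (α + 1)
  unifBound : ∀ K : Set ℝ, K ⊆ Set.Ioo (0 : ℝ) 2 → IsCompact K → ∀ p : ℕ,
    ∃ c > (0 : ℝ), ∃ C : ℝ, ∀ α ∈ K, ∀ y : ℝ, 1 ≤ |y| → |y| ≤ 3 →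
      c ≤ ψ α p y ∧ ψ α p y ≤ C

/-- `𝓘_α^{(k,l)}`. -/
def Ical (ψ : ℝ → ℕ → ℝ → ℝ) (α : ℝ) (k l : ℕ) (y : ℝ) : ℝ :=
  ∫ z in {z : ℝ | 1 < |z|}, Dop^[k] gauss (y - z) * ψ α l z

/-- `f_α^{(k,l,m)}`. -/
def fklm (α : ℝ) (k l m : ℕ) (y w : ℝ) : ℝ :=
  ∫ z : ℝ, Dop^[k] gauss (y - w * z)
    * Dop^[l] (fun z' => iteratedDeriv m (fun a => stableDensity a z') α) z

def Gamman (n : ℕ) (α : ℝ) : ℝ := Real.sqrt ((1 - α / 2) * Real.log n)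

def Mn (n : ℕ) (α : ℝ) : ℝ := Real.sqrt ((2 - α) * Real.log n)

def Kconst (σ δ α : ℝ) : ℝ := deriv cAlpha α + cAlpha α * Real.log (δ / σ)
lemma integral_Ioi_exp {E : Type*} [NormedAddCommGroup E] [NormedSpace ℝ E] (g : ℝ → E) :
    ∫ r in Ioi (0:ℝ), g r = ∫ s : ℝ, Real.exp s • g (Real.exp s) := by
  have h1 : Real.exp '' univ = Ioi 0 := by rw [image_univ, Real.range_exp]
  rw [← h1, integral_image_eq_integral_abs_deriv_smul MeasurableSet.univ
    (fun x _ => (Real.hasDerivAt_exp x).hasDerivWithinAt) Real.exp_injective.injOn]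
  simp

lemma integrableOn_Ioi_exp {E : Type*} [NormedAddCommGroup E] [NormedSpace ℝ E] (g : ℝ → E) :
    IntegrableOn g (Ioi (0:ℝ)) ↔ Integrable (fun s : ℝ => Real.exp s • g (Real.exp s)) := by
  have h1 : Real.exp '' univ = Ioi 0 := by rw [image_univ, Real.range_exp]
  rw [← h1, integrableOn_image_iff_integrableOn_abs_deriv_smul MeasurableSet.univ
    (fun x _ => (Real.hasDerivAt_exp x).hasDerivWithinAt) Real.exp_injective.injOn]
  simp

lemma gam_int {a b : ℝ} (ha : 0 < a) (hb : 0 < b) :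
    Integrable (fun s : ℝ => Real.exp (a * s - b * Real.exp s)) := by
  have h := integrableOn_rpow_mul_exp_neg_mul_rpow (s := a - 1) (p := 1) (b := b)
    (by linarith) one_pos hb
  rw [integrableOn_Ioi_exp] at h
  refine h.congr (Eventually.of_forall fun s => ?_)
  simp only [smul_eq_mul, Real.rpow_one]
  rw [← Real.exp_mul, ← Real.exp_add, ← Real.exp_add]
  ring_nf

lemma gam_val {a b : ℝ} (ha : 0 < a) (hb : 0 < b) :
    ∫ s : ℝ, Real.exp (a * s - b * Real.exp s) = Real.Gamma a * b ^ (-a) := by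
  have h := Real.integral_rpow_mul_exp_neg_mul_Ioi ha hb
  rw [integral_Ioi_exp] at h
  rw [Real.rpow_neg hb.le, ← Real.inv_rpow hb.le, mul_comm, ← one_div, ← h]
  refine integral_congr_ae (Eventually.of_forall fun s => ?_)
  simp only [smul_eq_mul]
  rw [← Real.exp_mul, ← Real.exp_add, ← Real.exp_add]
  ring_nf

/-- contour shift in a horizontal strip -/
lemma contour_shift (g : ℂ → ℂ) (hg : Differentiable ℂ g) (D : ℝ → ℝ) (ψ : ℝ) (hψ : 0 ≤ ψ)
    (hD : ∀ s u : ℝ, 0 ≤ u → u ≤ ψ → ‖g (s + u * Complex.I)‖ ≤ D s) (hDi : Integrable D)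
    (hT : Tendsto D atTop (𝓝 0)) (hB : Tendsto D atBot (𝓝 0)) :
    ∫ s : ℝ, g s = ∫ s : ℝ, g (s + ψ * Complex.I) := by
  have hc := hg.continuous
  have hint : ∀ u : ℝ, 0 ≤ u → u ≤ ψ → Integrable (fun s : ℝ => g (s + u * Complex.I)) := by
    intro u h0 h1
    refine hDi.mono' (by fun_prop) (Eventually.of_forall fun s => hD s u h0 h1)
  have hv : ∀ D' : ℝ → ℝ, Tendsto (fun T : ℝ => D (D' T)) atTop (𝓝 0) →
      Tendsto (fun T : ℝ => ∫ u in (0:ℝ)..ψ, g (D' T + u * Complex.I)) atTop (𝓝 0) := by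
    intro D' h
    rw [tendsto_zero_iff_norm_tendsto_zero]
    refine squeeze_zero (fun _ => norm_nonneg _) (g := fun T => D (D' T) * |ψ - 0|) (fun T => ?_) ?_
    · refine intervalIntegral.norm_integral_le_of_norm_le_const fun u hu => ?_
      rw [uIoc_of_le hψ] at hu
      exact hD _ _ hu.1.le hu.2
    · simpa using h.mul_const (|ψ - 0|)
  have h1 := hv (fun T => T) hT
  have h2 := hv (fun T => -T) (hB.comp tendsto_neg_atTop_atBot)
  have i1 := intervalIntegral_tendsto_integral (hint 0 le_rfl hψ) tendsto_neg_atTop_atBot tendsto_id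
  have i2 := intervalIntegral_tendsto_integral (hint ψ hψ le_rfl) tendsto_neg_atTop_atBot tendsto_id
  have key : ∀ T : ℝ, (∫ x in (-T)..T, g (x + (0:ℝ) * Complex.I)) - (∫ x in (-T)..T, g (x + ψ * Complex.I))
     + Complex.I * (∫ u in (0:ℝ)..ψ, g (T + u * Complex.I))
     - Complex.I * (∫ u in (0:ℝ)..ψ, g ((-T : ℝ) + u * Complex.I)) = 0 := by
    intro T
    have := Complex.integral_boundary_rect_eq_zero_of_differentiableOn g (-T : ℂ) (T + ψ * Complex.I)
      hg.differentiableOn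
    simpa using this
  have lim := ((i1.sub i2).add (h1.const_mul Complex.I)).sub (h2.const_mul Complex.I)
  have e : (∫ s : ℝ, g (s + (0:ℝ) * Complex.I)) - (∫ s : ℝ, g (s + ψ * Complex.I)) = 0 := by
    have := tendsto_nhds_unique lim (by
      simp only [id]
      simp only [key]
      exact tendsto_const_nhds)
    simpa using this
  have := sub_eq_zero.mp e
  simpa using this

/-- the entire integrand after the substitution `u = e^s` -/
def GG (α β t y : ℝ) (z : ℂ) : ℂ :=
  Complex.exp ((1 + β) * z + Complex.I * y * Complex.exp z - Complex.exp (2 * z) / 2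
    - t * Complex.exp (α * z))

lemma norm_GG (α β t y s u : ℝ) : ‖GG α β t y (s + u * Complex.I)‖ =
    Real.exp ((1 + β) * s - y * Real.exp s * Real.sin u - Real.exp (2 * s) * Real.cos (2 * u) / 2
      - t * (Real.exp (α * s) * Real.cos (α * u))) := by
  rw [GG, Complex.norm_exp]
  congr 1
  simp [Complex.exp_re, Complex.exp_im]
  ring

lemma norm_GG_le {α β t y s u : ℝ} (hα : α ∈ Ioo (0:ℝ) 2) (ht : 0 ≤ t) (hy : 0 ≤ y)
    (hu : 0 ≤ u) (hu' : u ≤ Real.pi / 6) : ‖GG α β t y (s + u * Complex.I)‖ ≤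
    Real.exp ((1 + β) * s - Real.exp (2 * s) / 4) := by
  have hpi := Real.pi_pos
  rw [norm_GG]
  have s1 : 0 ≤ Real.sin u := Real.sin_nonneg_of_nonneg_of_le_pi hu (by linarith)
  have s2 : 1 / 2 ≤ Real.cos (2 * u) := by
    rw [← Real.cos_pi_div_three]
    exact Real.cos_le_cos_of_nonneg_of_le_pi (by linarith) (by linarith) (by linarith)
  have s3 : 0 ≤ Real.cos (α * u) := by
    have : α * u ≤ 2 * u := by nlinarith [hα.2]
    have : 0 ≤ α * u := mul_nonneg hα.1.le hu
    exact Real.cos_nonneg_of_neg_pi_div_two_le_of_le (by linarith) (by linarith)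
  have e1 := Real.exp_pos s
  have e2 := Real.exp_pos (2 * s)
  have e3 := Real.exp_pos (α * s)
  apply Real.exp_le_exp.mpr
  have p1 : 0 ≤ y * Real.exp s * Real.sin u := by positivity
  have p2 : 0 ≤ t * (Real.exp (α * s) * Real.cos (α * u)) := by positivity
  nlinarith

lemma DD_int {β : ℝ} (hβ : 0 ≤ β) :
    Integrable (fun s : ℝ => Real.exp ((1 + β) * s - Real.exp (2 * s) / 4)) := by
  have := (gam_int (a := (1 + β) / 2) (b := 1 / 4) (by linarith) (by norm_num)).comp_mul_left'
    (R := 2) (by norm_num)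
  refine this.congr (Eventually.of_forall fun s => ?_)
  simp only
  congr 1
  ring

lemma DD_top {β : ℝ} : Tendsto (fun s : ℝ => Real.exp ((1 + β) * s - Real.exp (2 * s) / 4)) atTop (𝓝 0) := by
  have h := tendsto_rpow_mul_exp_neg_mul_atTop_nhds_zero ((1 + β) / 2) (1 / 4) (by norm_num)
  have h2 : Tendsto (fun s : ℝ => Real.exp (2 * s)) atTop atTop :=
    Real.tendsto_exp_atTop.comp (tendsto_id.const_mul_atTop (by norm_num : (0:ℝ) < 2))
  refine (h.comp h2).congr fun s => ?_
  simp only [Function.comp]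
  rw [← Real.exp_mul, ← Real.exp_add]
  congr 1; ring

lemma DD_bot {β : ℝ} (hβ : 0 ≤ β) :
    Tendsto (fun s : ℝ => Real.exp ((1 + β) * s - Real.exp (2 * s) / 4)) atBot (𝓝 0) := by
  have h2 : Tendsto (fun s : ℝ => Real.exp ((1 + β) * s)) atBot (𝓝 0) :=
    Real.tendsto_exp_atBot.comp (tendsto_id.const_mul_atBot (by linarith : (0:ℝ) < 1 + β))
  refine squeeze_zero (fun _ => (Real.exp_pos _).le) (fun s => ?_) h2
  apply Real.exp_le_exp.mpr
  linarith [Real.exp_pos (2 * s)]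

lemma GG_diff (α β t y : ℝ) : Differentiable ℂ (GG α β t y) := by
  unfold GG; fun_prop

lemma GG_shift {α β t y : ℝ} (hα : α ∈ Ioo (0:ℝ) 2) (hβ : 0 ≤ β) (ht : 0 ≤ t) (hy : 0 ≤ y) :
    ∫ s : ℝ, GG α β t y s = ∫ s : ℝ, GG α β t y (s + (Real.pi / 6 : ℝ) * Complex.I) :=
  contour_shift _ (GG_diff α β t y) _ _ (by positivity)
    (fun _ _ h0 h1 => norm_GG_le hα ht hy h0 h1) (DD_int hβ) DD_top (DD_bot hβ)

lemma GG_int {α β t y u : ℝ} (hα : α ∈ Ioo (0:ℝ) 2) (hβ : 0 ≤ β) (ht : 0 ≤ t) (hy : 0 ≤ y)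
    (hu : 0 ≤ u) (hu' : u ≤ Real.pi / 6) :
    Integrable (fun s : ℝ => GG α β t y (s + u * Complex.I)) := by
  have := (GG_diff α β t y).continuous
  exact (DD_int hβ).mono' (by fun_prop) (Eventually.of_forall fun s => norm_GG_le hα ht hy hu hu')


lemma main_val {a y : ℝ} (ha : 0 < a) (hy : 0 < y) :
    ∫ s : ℝ, Complex.exp (a * (s + (Real.pi / 6 : ℝ) * Complex.I)
      + Complex.I * y * Complex.exp (s + (Real.pi / 6 : ℝ) * Complex.I)) =
    Complex.exp ((a * (Real.pi / 2) : ℝ) * Complex.I) * (Real.Gamma a * y ^ (-a) : ℝ) := by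
  have hpi := Real.pi_pos
  have h := contour_shift (fun z => Complex.exp (a * (z + (Real.pi / 6 : ℝ) * Complex.I)
      + Complex.I * y * Complex.exp (z + (Real.pi / 6 : ℝ) * Complex.I))) (by fun_prop)
      (fun s => Real.exp (a * s - (y / 2) * Real.exp s)) (Real.pi / 3) (by positivity) ?_
      (gam_int ha (by linarith)) ?_ ?_
  · rw [h, ← gam_val ha hy, ← integral_complex_ofReal, ← integral_const_mul]
    refine integral_congr_ae (Eventually.of_forall fun s => ?_)
    simp only [Complex.ofReal_exp]
    have e1 : (s : ℂ) + (Real.pi / 3 : ℝ) * Complex.I + (Real.pi / 6 : ℝ) * Complex.I =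
      s + (Real.pi / 2 : ℂ) * Complex.I := by push_cast; ring
    rw [e1, Complex.exp_add (s : ℂ), Complex.exp_pi_div_two_mul_I, ← Complex.exp_add]
    congr 1
    push_cast
    linear_combination (y * Complex.exp s) * Complex.I_mul_I
  · intro s u h0 h1
    rw [Complex.norm_exp]
    apply Real.exp_le_exp.mpr
    have s2 : 1 / 2 ≤ Real.sin (u + Real.pi / 6) := by
      rw [← Real.sin_pi_div_six]
      exact Real.sin_le_sin_of_le_of_le_pi_div_two (by linarith) (by linarith) (by linarith)
    simp [Complex.exp_re, Complex.exp_im]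
    nlinarith [mul_pos hy (Real.exp_pos s)]
  · have h := tendsto_rpow_mul_exp_neg_mul_atTop_nhds_zero a (y / 2) (by linarith)
    refine (h.comp Real.tendsto_exp_atTop).congr fun s => ?_
    simp only [Function.comp]
    rw [← Real.exp_mul, ← Real.exp_add]
    congr 1; ring
  · have h2 : Tendsto (fun s : ℝ => Real.exp (a * s)) atBot (𝓝 0) :=
      Real.tendsto_exp_atBot.comp (tendsto_id.const_mul_atBot ha)
    refine squeeze_zero (fun _ => (Real.exp_pos _).le) (fun s => ?_) h2
    apply Real.exp_le_exp.mpr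
    nlinarith [mul_pos hy (Real.exp_pos s)]

lemma main_int {a y : ℝ} (ha : 0 < a) (hy : 0 < y) :
    Integrable (fun s : ℝ => Complex.exp (a * (s + (Real.pi / 6 : ℝ) * Complex.I)
      + Complex.I * y * Complex.exp (s + (Real.pi / 6 : ℝ) * Complex.I))) := by
  refine (gam_int ha (half_pos hy)).mono' (by fun_prop) (Eventually.of_forall fun s => ?_)
  rw [Complex.norm_exp]
  apply Real.exp_le_exp.mpr
  simp [Complex.exp_re, Complex.exp_im]
  linarith

lemma exp_half_one {z : ℂ} (hz : 0 ≤ z.re) : ‖Complex.exp (-z) - 1‖ ≤ ‖z‖ := by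
  have := (convex_halfSpace_re_ge (0:ℝ)).norm_image_sub_le_of_norm_hasDerivWithin_le
    (f := fun z => Complex.exp (-z)) (f' := fun z => Complex.exp (-z) * (-1)) (C := 1) (x := 0) (y := z)
    (fun x _ => ((hasDerivAt_neg x).cexp).hasDerivWithinAt)
    (fun x hx => by
      simp only [mul_neg, mul_one, norm_neg, Complex.norm_exp, Complex.neg_re]
      simpa using hx) (by simp) hz
  simpa using this

lemma exp_half_two {z : ℂ} (hz : 0 ≤ z.re) : ‖Complex.exp (-z) - 1 + z‖ ≤ ‖z‖ ^ 2 := by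
  have := ((convex_halfSpace_re_ge (0:ℝ)).inter (convex_closedBall (0:ℂ) ‖z‖)).norm_image_sub_le_of_norm_hasDerivWithin_le
    (f := fun z => Complex.exp (-z) + z) (f' := fun z => Complex.exp (-z) * (-1) + 1) (C := ‖z‖) (x := 0) (y := z)
    (fun x _ => (((hasDerivAt_neg x).cexp).add (hasDerivAt_id x)).hasDerivWithinAt)
    (fun x hx => by
      have h1 := exp_half_one (z := x) hx.1
      have h2 : ‖x‖ ≤ ‖z‖ := by simpa using hx.2
      rw [mul_neg, mul_one, neg_add_eq_sub, norm_sub_rev]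
      exact h1.trans h2) (by simp) ⟨hz, by simp⟩
  rw [sq]
  simpa [add_sub_right_comm] using this

/-- the elementary estimate with two half-plane variables -/
lemma exp_two {p q : ℂ} (hp : 0 ≤ p.re) (hq : 0 ≤ q.re) :
    ‖Complex.exp (-p) * (Complex.exp (-q) - 1) + q‖ ≤ ‖q‖ ^ 2 + ‖q‖ * ‖p‖ := by
  have e : Complex.exp (-p) * (Complex.exp (-q) - 1) + q =
    Complex.exp (-p) * (Complex.exp (-q) - 1 + q) - q * (Complex.exp (-p) - 1) := by ring
  have h1 : ‖Complex.exp (-p)‖ ≤ 1 := by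
    rw [Complex.norm_exp]; simpa using hp
  rw [e]
  refine (norm_sub_le _ _).trans (add_le_add ?_ ?_)
  · rw [norm_mul]
    calc _ ≤ 1 * ‖q‖ ^ 2 := by
          gcongr
          exact exp_half_two hq
      _ = _ := one_mul _
  · rw [norm_mul]
    gcongr
    exact exp_half_one hp

/-- the line integral of `GG` -/
def LL (α β t y : ℝ) : ℂ := ∫ s : ℝ, GG α β t y s

/-- the shifted point -/
def zz (s : ℝ) : ℂ := s + (Real.pi / 6 : ℝ) * Complex.I

lemma zz_re (s : ℝ) : (zz s).re = s := by simp [zz]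
lemma zz_im (s : ℝ) : (zz s).im = Real.pi / 6 := by simp [zz]

lemma norm_main (a y s : ℝ) : ‖Complex.exp (a * zz s + Complex.I * y * Complex.exp (zz s))‖ =
    Real.exp (a * s - y / 2 * Real.exp s) := by
  rw [Complex.norm_exp]
  congr 1
  simp [Complex.exp_re, Complex.exp_im, zz_re, zz_im]
  ring

lemma p_re (s : ℝ) : 0 ≤ (Complex.exp (2 * zz s) / 2).re := by
  have : (2:ℝ) * (Real.pi / 6) = Real.pi / 3 := by ring
  simp [Complex.exp_re, zz_re, zz_im, this]
  positivity

lemma p_norm (s : ℝ) : ‖Complex.exp (2 * zz s) / 2‖ ≤ Real.exp (2 * s) := by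
  rw [norm_div, Complex.norm_exp]
  simp [zz_re]
  positivity

lemma q_re {α t : ℝ} (hα : α ∈ Ioo (0:ℝ) 2) (ht : 0 ≤ t) (s : ℝ) :
    0 ≤ ((t : ℂ) * Complex.exp (α * zz s)).re := by
  have hpi := Real.pi_pos
  have s3 : 0 ≤ Real.cos (α * (Real.pi / 6)) := by
    have : α * (Real.pi / 6) ≤ 2 * (Real.pi / 6) := by nlinarith [hα.2]
    have : 0 ≤ α * (Real.pi / 6) := mul_nonneg hα.1.le (by linarith)
    exact Real.cos_nonneg_of_neg_pi_div_two_le_of_le (by linarith) (by linarith)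
  simp [Complex.exp_re, zz_re, zz_im]
  positivity

lemma q_norm {α t : ℝ} (ht : 0 ≤ t) (s : ℝ) :
    ‖(t : ℂ) * Complex.exp (α * zz s)‖ = t * Real.exp (α * s) := by
  rw [norm_mul, Complex.norm_exp]
  simp [zz_re, abs_of_nonneg ht]

lemma GG_int_zz {α β t y : ℝ} (hα : α ∈ Ioo (0:ℝ) 2) (hβ : 0 ≤ β) (ht : 0 ≤ t) (hy : 0 ≤ y) :
    Integrable (fun s : ℝ => GG α β t y (zz s)) :=
  GG_int hα hβ ht hy (by positivity) le_rfl

lemma LL_zz {α β t y : ℝ} (hα : α ∈ Ioo (0:ℝ) 2) (hβ : 0 ≤ β) (ht : 0 ≤ t) (hy : 0 ≤ y) :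
    LL α β t y = ∫ s : ℝ, GG α β t y (zz s) := GG_shift hα hβ ht hy

/-- the main constant -/
def EE (α y : ℝ) : ℂ := Complex.exp (((1 + α) * (Real.pi / 2) : ℝ) * Complex.I) *
  (Real.Gamma (1 + α) * y ^ (-(1 + α)) : ℝ)

lemma EE_eq {α y : ℝ} (hα : 0 < 1 + α) (hy : 0 < y) :
    EE α y = ∫ s : ℝ, Complex.exp ((1 + α : ℝ) * zz s + Complex.I * y * Complex.exp (zz s)) :=
  (main_val hα hy).symm

lemma main_int_zz {a y : ℝ} (ha : 0 < a) (hy : 0 < y) :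
    Integrable (fun s : ℝ => Complex.exp (a * zz s + Complex.I * y * Complex.exp (zz s))) :=
  main_int ha hy

lemma H_asymp {α t y : ℝ} (hα : α ∈ Ioo (0:ℝ) 2) (ht : 0 ≤ t) (hy : 0 < y) :
    ‖LL α α t y - EE α y‖ ≤ Real.Gamma (3 + α) * (y / 2) ^ (-(3 + α)) +
      t * (Real.Gamma (1 + 2 * α) * (y / 2) ^ (-(1 + 2 * α))) := by
  have h0 := hα.1
  have hy2 := half_pos hy
  have i1 := gam_int (a := 3 + α) (by linarith) hy2
  have i2 := gam_int (a := 1 + 2 * α) (by linarith) hy2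
  rw [LL_zz hα h0.le ht hy.le, EE_eq (by linarith) hy,
    ← integral_sub (GG_int_zz hα h0.le ht hy.le) (main_int_zz (by linarith) hy),
    ← gam_val (by linarith) hy2, ← gam_val (by linarith) hy2, ← integral_const_mul,
    ← integral_add i1 (i2.const_mul t)]
  refine norm_integral_le_of_norm_le (i1.add (i2.const_mul t)) (Eventually.of_forall fun s => ?_)
  have e : GG α α t y (zz s) - Complex.exp ((1 + α : ℝ) * zz s + Complex.I * y * Complex.exp (zz s))
    = Complex.exp ((1 + α : ℝ) * zz s + Complex.I * y * Complex.exp (zz s)) *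
      (Complex.exp (-(Complex.exp (2 * zz s) / 2 + t * Complex.exp (α * zz s))) - 1) := by
    rw [mul_sub, ← Complex.exp_add, mul_one, GG]
    congr 2
    push_cast
    ring
  rw [e, norm_mul, norm_main]
  have hb := exp_half_one (z := Complex.exp (2 * zz s) / 2 + t * Complex.exp (α * zz s))
    (by rw [Complex.add_re]; exact add_nonneg (p_re s) (q_re hα ht s))
  have hb2 := (hb.trans (norm_add_le _ _)).trans (add_le_add (p_norm s) (q_norm ht s).le)
  refine (mul_le_mul_of_nonneg_left hb2 (Real.exp_pos _).le).trans (le_of_eq ?_)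
  rw [mul_add, ← Real.exp_add, mul_left_comm, ← Real.exp_add]
  ring_nf

lemma F_asymp {α t y : ℝ} (hα : α ∈ Ioo (0:ℝ) 2) (ht : 0 ≤ t) (hy : 0 < y) :
    ‖LL α 0 t y - LL α 0 0 y + t * EE α y‖ ≤ t ^ 2 * (Real.Gamma (1 + 2 * α) * (y / 2) ^ (-(1 + 2 * α)))
     + t * (Real.Gamma (3 + α) * (y / 2) ^ (-(3 + α))) := by
  have h0 := hα.1
  have hy2 := half_pos hy
  have i1 := gam_int (a := 3 + α) (by linarith) hy2
  have i2 := gam_int (a := 1 + 2 * α) (by linarith) hy2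
  have j1 := GG_int_zz (β := 0) hα le_rfl ht hy.le
  have j2 := GG_int_zz (β := 0) hα le_rfl le_rfl hy.le
  have j3 := (main_int_zz (a := 1 + α) (by linarith) hy).const_mul (t : ℂ)
  rw [LL_zz hα le_rfl ht hy.le, LL_zz hα le_rfl le_rfl hy.le, EE_eq (by linarith) hy,
    ← integral_sub j1 j2, ← integral_const_mul]
  have := integral_add (j1.sub j2) j3
  simp only [Pi.sub_apply] at this
  rw [← this]
  rw [← gam_val (by linarith) hy2, ← gam_val (by linarith) hy2, ← integral_const_mul,
    ← integral_const_mul, ← integral_add (i2.const_mul _) (i1.const_mul t)]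
  refine norm_integral_le_of_norm_le ((i2.const_mul _).add (i1.const_mul t)) (Eventually.of_forall fun s => ?_)
  change ‖GG α 0 t y (zz s) - GG α 0 0 y (zz s) + t * Complex.exp ((1 + α : ℝ) * zz s + Complex.I * y * Complex.exp (zz s))‖ ≤ _
  have e : GG α 0 t y (zz s) - GG α 0 0 y (zz s) + t * Complex.exp ((1 + α : ℝ) * zz s + Complex.I * y * Complex.exp (zz s))
    = Complex.exp ((1 : ℝ) * zz s + Complex.I * y * Complex.exp (zz s)) *
      (Complex.exp (-(Complex.exp (2 * zz s) / 2)) * (Complex.exp (-(t * Complex.exp (α * zz s))) - 1)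
        + t * Complex.exp (α * zz s)) := by
    have e1 : Complex.exp ((1 + α : ℝ) * zz s + Complex.I * y * Complex.exp (zz s)) =
      Complex.exp ((1 : ℝ) * zz s + Complex.I * y * Complex.exp (zz s)) * Complex.exp (α * zz s) := by
      rw [← Complex.exp_add]; congr 1; push_cast; ring
    have e2 : GG α 0 t y (zz s) = Complex.exp ((1 : ℝ) * zz s + Complex.I * y * Complex.exp (zz s)) *
       Complex.exp (-(Complex.exp (2 * zz s) / 2)) * Complex.exp (-(t * Complex.exp (α * zz s))) := by
      rw [← Complex.exp_add, ← Complex.exp_add, GG]; congr 1; push_cast; ring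
    have e3 : GG α 0 0 y (zz s) = Complex.exp ((1 : ℝ) * zz s + Complex.I * y * Complex.exp (zz s)) *
       Complex.exp (-(Complex.exp (2 * zz s) / 2)) := by
      rw [← Complex.exp_add, GG]; congr 1; push_cast; ring
    rw [e1, e2, e3]; ring
  rw [e, norm_mul, norm_main]
  have hb := exp_two (p_re s) (q_re hα ht s)
  rw [q_norm ht] at hb
  have hb2 := hb.trans (add_le_add le_rfl (mul_le_mul_of_nonneg_left (p_norm s)
    (mul_nonneg ht (Real.exp_pos _).le)))
  refine (mul_le_mul_of_nonneg_left hb2 (Real.exp_pos _).le).trans (le_of_eq ?_)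
  have e1 : Real.exp ((1 + 2 * α) * s - y / 2 * Real.exp s) =
    Real.exp (1 * s - y / 2 * Real.exp s) * Real.exp (α * s) * Real.exp (α * s) := by
    rw [← Real.exp_add, ← Real.exp_add]; ring_nf
  have e2 : Real.exp ((3 + α) * s - y / 2 * Real.exp s) =
    Real.exp (1 * s - y / 2 * Real.exp s) * Real.exp (α * s) * Real.exp (2 * s) := by
    rw [← Real.exp_add, ← Real.exp_add]; ring_nf
  rw [e1, e2]; ring

lemma norm_GG_real {α β t y s : ℝ} (hα : α ∈ Ioo (0:ℝ) 2) (ht : 0 ≤ t) (hy : 0 ≤ y) :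
    ‖GG α β t y s‖ ≤ Real.exp ((1 + β) * s - Real.exp (2 * s) / 4) := by
  have := norm_GG_le (β := β) (s := s) hα ht hy le_rfl (by positivity)
  simpa using this

lemma GG_int_real {α β t y : ℝ} (hα : α ∈ Ioo (0:ℝ) 2) (hβ : 0 ≤ β) (ht : 0 ≤ t) (hy : 0 ≤ y) :
    Integrable (fun s : ℝ => GG α β t y s) := by
  have := GG_int hα hβ ht hy le_rfl (by positivity)
  simpa using this

/-- the crude constant -/
def DC (β : ℝ) : ℝ := ∫ s : ℝ, Real.exp ((1 + β) * s - Real.exp (2 * s) / 4)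

lemma H_crude {α t y : ℝ} (hα : α ∈ Ioo (0:ℝ) 2) (ht : 0 ≤ t) (hy : 0 ≤ y) :
    ‖LL α α t y‖ ≤ DC α :=
  norm_integral_le_of_norm_le (DD_int hα.1.le) (Eventually.of_forall fun _ => norm_GG_real hα ht hy)

lemma F_crude {α t y : ℝ} (hα : α ∈ Ioo (0:ℝ) 2) (ht : 0 ≤ t) (hy : 0 ≤ y) :
    ‖LL α 0 t y - LL α 0 0 y‖ ≤ t * DC α := by
  have j1 := GG_int_real (β := 0) hα le_rfl ht hy
  have j2 := GG_int_real (β := 0) hα le_rfl le_rfl hy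
  rw [LL, LL, ← integral_sub j1 j2, DC, ← integral_const_mul]
  refine norm_integral_le_of_norm_le ((DD_int hα.1.le).const_mul t) (Eventually.of_forall fun s => ?_)
  have e2 : GG α 0 t y s - GG α 0 0 y s = GG α 0 0 y s * (Complex.exp (-(t * Complex.exp (α * s))) - 1) := by
    rw [mul_sub, mul_one, GG, GG, ← Complex.exp_add]; congr 2; push_cast; ring
  have e3 : (t : ℂ) * Complex.exp (α * s) = (t * Real.exp (α * s) : ℝ) := by push_cast; rfl
  have h1 := norm_GG_real (β := 0) (s := s) hα le_rfl hy
  have h2 := exp_half_one (z := t * Complex.exp (α * s)) (by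
    rw [e3, Complex.ofReal_re]; positivity)
  have h3 : ‖(t : ℂ) * Complex.exp (α * s)‖ = t * Real.exp (α * s) := by
    rw [e3, Complex.norm_real, Real.norm_of_nonneg (by positivity)]
  rw [h3] at h2
  rw [e2, norm_mul]
  refine (mul_le_mul h1 h2 (norm_nonneg _) (Real.exp_pos _).le).trans (le_of_eq ?_)
  rw [mul_left_comm, ← Real.exp_add]; ring_nf

/-- the tail constant -/
def cc0 (α : ℝ) : ℝ := Real.Gamma (1 + α) * Real.sin (Real.pi * α / 2) / Real.pi

lemma cc0_pos {α : ℝ} (hα : α ∈ Ioo (0:ℝ) 2) : 0 < cc0 α := by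
  have h1 := Real.Gamma_pos_of_pos (show 0 < 1 + α by linarith [hα.1])
  have h2 : 0 < Real.sin (Real.pi * α / 2) := by
    apply Real.sin_pos_of_pos_of_lt_pi
    · have := hα.1; positivity
    · nlinarith [Real.pi_pos, hα.2]
  have := Real.pi_pos
  unfold cc0; positivity

lemma EE_re (α y : ℝ) : (EE α y).re = - Real.pi * (cc0 α * y ^ (-(1 + α))) := by
  rw [EE, Complex.re_mul_ofReal, Complex.exp_ofReal_mul_I_re, cc0]
  have : (1 + α) * (Real.pi / 2) = Real.pi * α / 2 + Real.pi / 2 := by ring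
  rw [this, Real.cos_add_pi_div_two]
  field_simp

lemma cAlpha_eq {α : ℝ} (hα : α ∈ Ioo (0:ℝ) 2) : cAlpha α = cc0 α := by
  unfold cAlpha cc0
  have hpi := Real.pi_pos
  split_ifs with h
  · subst h
    rw [show (1:ℝ) + 1 = 2 by norm_num, Real.Gamma_two, mul_one, Real.sin_pi_div_two]; ring
  · have h1 : Real.Gamma (2 - α) = (1 - α) * Real.Gamma (1 - α) := by
      rw [← Real.Gamma_add_one (sub_ne_zero.mpr (Ne.symm h))]; ring_nf
    have h2 : Real.Gamma (1 + α) = α * Real.Gamma α := by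
      rw [add_comm, Real.Gamma_add_one hα.1.ne']
    have h3 := Real.Gamma_mul_Gamma_one_sub α
    have h4 : Real.sin (Real.pi * α) = 2 * Real.sin (Real.pi * α / 2) * Real.cos (Real.pi * α / 2) := by
      rw [← Real.sin_two_mul]; ring_nf
    have h5 : Real.cos (Real.pi * α / 2) ≠ 0 := by
      intro h5
      rcases Real.cos_eq_zero_iff.mp h5 with ⟨k, hk⟩
      have hk' : α = 2 * k + 1 := by field_simp at hk; linarith
      have h6 : (-1 : ℝ) < k := by linarith [hα.1]
      have h7 : (k : ℝ) < 1 := by linarith [hα.2]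
      have h8 : (-1 : ℤ) < k := by exact_mod_cast h6
      have h9 : k < (1 : ℤ) := by exact_mod_cast h7
      have : k = 0 := by omega
      rw [this] at hk'; simp at hk'; exact h hk'
    have h6 : Real.sin (Real.pi * α / 2) ≠ 0 := by
      have := cc0_pos hα
      intro h; rw [cc0, h] at this; simp at this
    have h7 : Real.Gamma (1 - α) ≠ 0 := by
      intro h; rw [h, mul_zero, h4] at h3
      have : Real.pi / (2 * Real.sin (Real.pi * α / 2) * Real.cos (Real.pi * α / 2)) ≠ 0 := by positivity
      exact this h3.symm
    have h8 : 1 - α ≠ 0 := sub_ne_zero.mpr (Ne.symm h)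
    have h9 : Real.Gamma α = Real.pi / (2 * Real.sin (Real.pi * α / 2) * Real.cos (Real.pi * α / 2)) / Real.Gamma (1 - α) := by
      rw [← h4, ← h3]; field_simp
    rw [h1, h2, h9]
    generalize Real.sin (Real.pi * α / 2) = S at *
    generalize Real.cos (Real.pi * α / 2) = T at *
    generalize Real.Gamma (1 - α) = U at *
    field_simp
    ring

lemma gauss_cos (y w u : ℝ) (hw : 0 < w) :
    ∫ z : ℝ, gauss (y - w * z) * Real.cos (z * u) =
      w⁻¹ * (Real.cos (y * (u / w)) * Real.exp (-(u / w) ^ 2 / 2)) := by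
  have hb : (-(w ^ 2 / 2 : ℝ) : ℂ).re < 0 := by
    rw [← Complex.ofReal_neg, Complex.ofReal_re]; nlinarith [sq_pos_of_pos hw]
  have hI := integral_cexp_quadratic hb (y * w + u * Complex.I) (-(y ^ 2) / 2)
  have hJ := integrable_cexp_quadratic' hb (y * w + u * Complex.I) (-(y ^ 2) / 2)
  have hre : ∀ z : ℝ, gauss (y - w * z) * Real.cos (z * u) = (Real.sqrt (2 * Real.pi))⁻¹ *
      (Complex.exp (-(w ^ 2 / 2 : ℝ) * z ^ 2 + (y * w + u * Complex.I) * z + (-(y ^ 2) / 2))).re := by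
    intro z
    have : (-(w ^ 2 / 2 : ℝ) * z ^ 2 + (y * w + u * Complex.I) * z + (-(y ^ 2) / 2) : ℂ) =
      ((-((y - w * z) ^ 2) / 2 : ℝ) : ℂ) + ((z * u : ℝ) : ℂ) * Complex.I := by
      push_cast; ring
    rw [this, Complex.exp_add, ← Complex.ofReal_exp, Complex.re_ofReal_mul,
      Complex.exp_ofReal_mul_I_re, gauss]
    ring
  simp_rw [hre]
  rw [integral_const_mul]
  have h3 : ∫ z : ℝ, (Complex.exp (-(w ^ 2 / 2 : ℝ) * z ^ 2 + (y * w + u * Complex.I) * z + (-(y ^ 2) / 2))).re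
    = (∫ z : ℝ, Complex.exp (-(w ^ 2 / 2 : ℝ) * z ^ 2 + (y * w + u * Complex.I) * z + (-(y ^ 2) / 2))).re :=
    integral_re hJ
  rw [h3, hI]
  have h4 : (Real.pi / -(-((w ^ 2 / 2 : ℝ) : ℂ))) ^ (1 / 2 : ℂ) = ((Real.sqrt (2 * Real.pi) * w⁻¹ : ℝ) : ℂ) := by
    have e : (Real.pi / -(-((w ^ 2 / 2 : ℝ) : ℂ))) = ((2 * Real.pi / w ^ 2 : ℝ) : ℂ) := by
      push_cast; field_simp
    rw [e, show (1 / 2 : ℂ) = ((1 / 2 : ℝ) : ℂ) by push_cast; rfl,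
      ← Complex.ofReal_cpow (by positivity), ← Real.sqrt_eq_rpow, Real.sqrt_div (by positivity),
      Real.sqrt_sq hw.le, div_eq_mul_inv]
  have hw' : (w : ℂ) ≠ 0 := by exact_mod_cast hw.ne'
  have h5 : (-(y ^ 2) / 2 - (y * w + u * Complex.I) ^ 2 / (4 * (-(w ^ 2 / 2 : ℝ))) : ℂ) =
      ((-(u / w) ^ 2 / 2 : ℝ) : ℂ) + ((y * (u / w) : ℝ) : ℂ) * Complex.I := by
    push_cast
    field_simp
    linear_combination (4 * (u:ℂ) ^ 2) * Complex.I_sq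
  rw [h4, h5, Complex.exp_add, ← Complex.ofReal_exp, Complex.re_ofReal_mul, Complex.re_ofReal_mul,
      Complex.exp_ofReal_mul_I_re]
  have : Real.sqrt (2 * Real.pi) ≠ 0 := by positivity
  field_simp

lemma gauss_cont : Continuous gauss := by unfold gauss; fun_prop

lemma gauss_nonneg (y : ℝ) : 0 ≤ gauss y := by unfold gauss; positivity

lemma gauss_int {y w : ℝ} (hw : 0 < w) : Integrable (fun z : ℝ => gauss (y - w * z)) := by
  by_contra h
  have h1 := gauss_cos y w 0 hw
  simp only [mul_zero, Real.cos_zero, mul_one, zero_div] at h1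
  rw [integral_undef h] at h1
  simp at h1
  exact hw.ne h1

lemma fubini_gauss {K : ℝ → ℝ} (hK : Integrable K) (y w : ℝ) (hw : 0 < w) :
    ∫ z : ℝ, gauss (y - w * z) * ((2 * Real.pi)⁻¹ * ∫ u : ℝ, Real.cos (z * u) * K u) =
      (2 * Real.pi)⁻¹ * ∫ v : ℝ, Real.cos (y * v) * (Real.exp (-v ^ 2 / 2) * K (w * v)) := by
  have h1 : ∀ z : ℝ, gauss (y - w * z) * ((2 * Real.pi)⁻¹ * ∫ u : ℝ, Real.cos (z * u) * K u) =
     (2 * Real.pi)⁻¹ * ∫ u : ℝ, gauss (y - w * z) * (Real.cos (z * u) * K u) := by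
    intro z; rw [integral_const_mul]; ring
  simp_rw [h1]
  rw [integral_const_mul]
  congr 1
  rw [integral_integral_swap]
  · have h2 : ∀ u : ℝ, ∫ z : ℝ, gauss (y - w * z) * (Real.cos (z * u) * K u) =
      w⁻¹ * (Real.cos (y * (u / w)) * (Real.exp (-(u / w) ^ 2 / 2) * K (w * (u / w)))) := by
      intro u
      simp_rw [← mul_assoc]
      rw [integral_mul_const, gauss_cos y w u hw, mul_div_cancel₀ _ hw.ne']
      ring
    simp_rw [h2]
    rw [integral_const_mul, Measure.integral_comp_div (fun v => Real.cos (y * v) * (Real.exp (-v ^ 2 / 2) * K (w * v))),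
      abs_of_pos hw, smul_eq_mul, inv_mul_cancel_left₀ hw.ne']
  · have := (gauss_int (y := y) hw).mul_prod hK
    refine this.mono ?_ (Eventually.of_forall fun p => ?_)
    · have e : (Function.uncurry fun z u : ℝ => gauss (y - w * z) * (Real.cos (z * u) * K u)) =
        fun p : ℝ × ℝ => Real.cos (p.1 * p.2) * (gauss (y - w * p.1) * K p.2) := by
        ext p; simp [Function.uncurry]; ring
      rw [e]
      exact (Continuous.aestronglyMeasurable (by fun_prop)).mul this.aestronglyMeasurable
    · simp only [Function.uncurry, norm_mul]
      gcongr
      refine mul_le_of_le_one_left (norm_nonneg _) (Real.abs_cos_le_one _)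

lemma abs_int {α β b : ℝ} (hα : 0 < α) (hβ : 0 ≤ β) (hb : 0 < b) :
    Integrable (fun u : ℝ => |u| ^ β * Real.exp (-b * |u| ^ α)) := by
  by_contra h
  have h1 := integral_comp_abs (f := fun u : ℝ => u ^ β * Real.exp (-b * u ^ α))
  rw [integral_undef h, integral_rpow_mul_exp_neg_mul_rpow hα (by linarith) hb] at h1
  have : 0 < Real.Gamma ((β + 1) / α) := Real.Gamma_pos_of_pos (by positivity)
  have : 0 < 2 * (b ^ (-(β + 1) / α) * (1 / α) * Real.Gamma ((β + 1) / α)) := by positivity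
  exact this.ne h1

lemma st_int {α : ℝ} (hα : 0 < α) : Integrable (fun u : ℝ => Real.exp (-(|u| ^ α))) := by
  simpa using abs_int hα le_rfl one_pos

lemma st_int' {α : ℝ} (hα : 0 < α) : Integrable (fun u : ℝ => α * |u| ^ α * Real.exp (-(|u| ^ α))) := by
  simpa [mul_assoc] using (abs_int hα hα.le one_pos).const_mul α

/-- scaling form of the stable density -/
lemma stable_scale (α z s : ℝ) (hs : 0 < s) : s * stableDensity α (s * z) =
    (2 * Real.pi)⁻¹ * ∫ v : ℝ, Real.cos (z * v) * Real.exp (-(|v| ^ α * s ^ (-α))) := by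
  have := Measure.integral_comp_mul_left
    (fun v : ℝ => Real.cos (z * v) * Real.exp (-(|v| ^ α * s ^ (-α)))) s
  rw [abs_of_pos (inv_pos.mpr hs), smul_eq_mul] at this
  have h2 : ∫ v : ℝ, Real.cos (z * v) * Real.exp (-(|v| ^ α * s ^ (-α))) =
    s * ∫ u : ℝ, Real.cos (z * (s * u)) * Real.exp (-(|s * u| ^ α * s ^ (-α))) := by
    rw [this, mul_inv_cancel_left₀ hs.ne']
  rw [h2, stableDensity]
  have h3 : ∀ u : ℝ, Real.cos (z * (s * u)) * Real.exp (-(|s * u| ^ α * s ^ (-α))) =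
    Real.cos (s * z * u) * Real.exp (-(|u| ^ α)) := by
    intro u
    rw [abs_mul, abs_of_pos hs, Real.mul_rpow hs.le (abs_nonneg _), mul_right_comm,
      ← Real.rpow_add hs, add_neg_cancel, Real.rpow_zero, one_mul]
    ring_nf
  simp_rw [h3]
  ring

lemma stable_scale_deriv {α : ℝ} (hα : 0 < α) (z : ℝ) :
    HasDerivAt (fun s => s * stableDensity α (s * z))
      ((2 * Real.pi)⁻¹ * ∫ v : ℝ, Real.cos (z * v) * (α * |v| ^ α * Real.exp (-(|v| ^ α)))) 1 := by
  have h := (hasDerivAt_integral_of_dominated_loc_of_deriv_le (μ := volume) (𝕜 := ℝ)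
    (F := fun s v : ℝ => Real.cos (z * v) * Real.exp (-(|v| ^ α * s ^ (-α))))
    (F' := fun s v : ℝ => Real.cos (z * v) * (Real.exp (-(|v| ^ α * s ^ (-α))) * -(|v| ^ α * (-α * s ^ (-α - 1)))))
    (x₀ := 1) (s := Ioo (1 / 2) 2)
    (bound := fun v => (α * (1 / 2) ^ (-α - 1)) * (|v| ^ α * Real.exp (-(2 ^ (-α)) * |v| ^ α)))
    (Ioo_mem_nhds (by norm_num) (by norm_num)) ?_ ?_ ?_ ?_ ?_ ?_).2
  · have h2 := h.const_mul (2 * Real.pi)⁻¹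
    simp only [Real.one_rpow, mul_one] at h2
    refine HasDerivAt.congr_of_eventuallyEq ?_ (f := fun s => (2 * Real.pi)⁻¹ *
      ∫ v : ℝ, Real.cos (z * v) * Real.exp (-(|v| ^ α * s ^ (-α)))) ?_
    · have e : (fun v : ℝ => Real.cos (z * v) * (α * |v| ^ α * Real.exp (-(|v| ^ α)))) =
          fun v : ℝ => Real.cos (z * v) * (Real.exp (-|v| ^ α) * -(|v| ^ α * -α)) := by
        funext v; ring
      rw [e]
      exact h2
    · filter_upwards [lt_mem_nhds (show (0:ℝ) < 1 by norm_num)] with s hs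
      exact stable_scale α z s hs
  · refine Eventually.of_forall fun s => Continuous.aestronglyMeasurable ?_
    have : Continuous fun v : ℝ => |v| ^ α := (continuous_abs).rpow_const (fun _ => Or.inr hα.le)
    fun_prop
  · refine (st_int hα).mono' ?_ (Eventually.of_forall fun v => ?_)
    · have : Continuous fun v : ℝ => |v| ^ α := (continuous_abs).rpow_const (fun _ => Or.inr hα.le)
      exact Continuous.aestronglyMeasurable (by fun_prop)
    · simp only [Real.one_rpow, mul_one, norm_mul, Real.norm_eq_abs, Real.abs_exp]
      exact mul_le_of_le_one_left (Real.exp_pos _).le (Real.abs_cos_le_one _)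
  · have : Continuous fun v : ℝ => |v| ^ α := (continuous_abs).rpow_const (fun _ => Or.inr hα.le)
    exact Continuous.aestronglyMeasurable (by fun_prop)
  · refine Eventually.of_forall fun v s hs => ?_
    have hs0 : 0 < s := by linarith [hs.1]
    have hv : 0 ≤ |v| ^ α := by positivity
    have e1 : s ^ (-α - 1) ≤ (1 / 2) ^ (-α - 1) :=
      Real.rpow_le_rpow_of_nonpos (by norm_num) hs.1.le (by linarith)
    have e2 : (2:ℝ) ^ (-α) ≤ s ^ (-α) :=
      Real.rpow_le_rpow_of_nonpos hs0 hs.2.le (by linarith)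
    have e3 : 0 < s ^ (-α - 1) := by positivity
    rw [norm_mul, norm_mul, Real.norm_eq_abs, Real.norm_eq_abs, Real.norm_eq_abs, Real.abs_exp,
      show -(|v| ^ α * (-α * s ^ (-α - 1))) = |v| ^ α * (α * s ^ (-α - 1)) by ring,
      abs_of_nonneg (a := |v| ^ α * (α * s ^ (-α - 1))) (by positivity)]
    have e4 : Real.exp (-(|v| ^ α * s ^ (-α))) ≤ Real.exp (-(2 ^ (-α)) * |v| ^ α) := by
      apply Real.exp_le_exp.mpr; nlinarith
    calc _ ≤ 1 * (Real.exp (-(2 ^ (-α)) * |v| ^ α) * (|v| ^ α * (α * (1 / 2) ^ (-α - 1)))) := by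
          gcongr
          exact Real.abs_cos_le_one _
      _ = _ := by ring
  · exact (abs_int hα hα.le (by positivity)).const_mul _
  · refine Eventually.of_forall fun v s hs => ?_
    have hs0 : 0 < s := by linarith [hs.1]
    have := ((((Real.hasDerivAt_rpow_const (p := -α) (Or.inl hs0.ne')).const_mul (|v| ^ α)).neg).exp).const_mul (Real.cos (z * v))
    exact this

lemma Dop_stable {α : ℝ} (hα : 0 < α) (z : ℝ) : Dop (stableDensity α) z =
    (2 * Real.pi)⁻¹ * ∫ v : ℝ, Real.cos (z * v) * (α * |v| ^ α * Real.exp (-(|v| ^ α))) := by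
  have h := stable_scale_deriv hα z
  by_cases hz : z = 0
  · subst hz
    have h2 : HasDerivAt (fun s : ℝ => s * stableDensity α (s * 0)) (stableDensity α 0) 1 := by
      simpa using (hasDerivAt_id (1:ℝ)).mul_const (stableDensity α 0)
    rw [h.unique h2, Dop]; simp
  · have hd : DifferentiableAt ℝ (stableDensity α) z := by
      have h0 : HasDerivAt (fun s => s * stableDensity α (s * z)) ((2 * Real.pi)⁻¹ *
          ∫ v : ℝ, Real.cos (z * v) * (α * |v| ^ α * Real.exp (-(|v| ^ α)))) (z / z) := by
        rw [div_self hz]; exact h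
      have h01 : HasDerivAt (fun x : ℝ => x / z) (1 / z) z := (hasDerivAt_id z).div_const z
      have h1 := (HasDerivAt.comp (h₂ := fun s => s * stableDensity α (s * z))
        (h := fun x : ℝ => x / z) z h0 h01).differentiableAt
      have h2 := (differentiableAt_inv hz).mul h1 |>.const_mul z
      refine h2.congr_of_eventuallyEq ?_
      filter_upwards [isOpen_ne.mem_nhds hz] with x hx
      have hx' : x ≠ 0 := hx
      simp only [Function.comp, id, Pi.mul_apply]
      rw [div_mul_cancel₀ _ hz]
      field_simp
    have h3 : HasDerivAt (fun s : ℝ => s * stableDensity α (s * z))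
        (1 * stableDensity α (1 * z) + 1 * (deriv (stableDensity α) z * (1 * z))) 1 := by
      have h4 : HasDerivAt (stableDensity α) (deriv (stableDensity α) z) (1 * z) := by
        rw [one_mul]; exact hd.hasDerivAt
      have h6 : HasDerivAt (fun s : ℝ => s * z) (1 * z) 1 := (hasDerivAt_id (1:ℝ)).mul_const z
      have h5 := HasDerivAt.comp (h₂ := stableDensity α) (h := fun s : ℝ => s * z) 1 h4 h6
      exact (hasDerivAt_id (1:ℝ)).mul h5
    rw [h.unique h3, Dop]
    ring_nf

lemma fFun_eq {α : ℝ} (hα : 0 < α) (y w : ℝ) (hw : 0 < w) : fFun α y w =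
    (2 * Real.pi)⁻¹ * ∫ v : ℝ, Real.cos (y * v) * (Real.exp (-v ^ 2 / 2) * Real.exp (-(|w * v| ^ α))) :=
  fubini_gauss (st_int hα) y w hw

lemma hFun_eq {α : ℝ} (hα : 0 < α) (y w : ℝ) (hw : 0 < w) : hFun α y w =
    (2 * Real.pi)⁻¹ * ∫ v : ℝ, Real.cos (y * v) * (Real.exp (-v ^ 2 / 2) *
      (α * |w * v| ^ α * Real.exp (-(|w * v| ^ α)))) := by
  rw [← fubini_gauss (st_int' hα) y w hw, hFun]
  simp_rw [Dop_stable hα]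

lemma cos_cont {K : ℝ → ℝ} (hK : Integrable K) : Continuous (fun y : ℝ => ∫ v : ℝ, Real.cos (y * v) * K v) := by
  refine continuous_of_dominated (bound := fun v => ‖K v‖) ?_ ?_ hK.norm ?_
  · intro y
    exact (Continuous.aestronglyMeasurable (by fun_prop)).mul hK.aestronglyMeasurable
  · intro y
    refine Eventually.of_forall fun v => ?_
    rw [norm_mul]
    exact mul_le_of_le_one_left (norm_nonneg _) (Real.abs_cos_le_one _)
  · refine Eventually.of_forall fun v => by fun_prop

lemma mul_gauss_int {K : ℝ → ℝ} (hK : Integrable K) :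
    Integrable (fun v : ℝ => Real.exp (-v ^ 2 / 2) * K v) := by
  refine hK.norm.mono' ((Continuous.aestronglyMeasurable (by fun_prop)).mul hK.aestronglyMeasurable)
    (Eventually.of_forall fun v => ?_)
  rw [norm_mul]
  refine mul_le_of_le_one_left (norm_nonneg _) ?_
  rw [Real.norm_eq_abs, Real.abs_exp, Real.exp_le_one_iff]
  nlinarith [sq_nonneg v]

lemma fFun_cont {α : ℝ} (hα : 0 < α) (w : ℝ) (hw : 0 < w) : Continuous (fun y => fFun α y w) := by
  simp_rw [fFun_eq hα _ w hw]
  exact (cos_cont (mul_gauss_int ((st_int hα).comp_mul_left' hw.ne'))).const_mul _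

lemma hFun_cont {α : ℝ} (hα : 0 < α) (w : ℝ) (hw : 0 < w) : Continuous (fun y => hFun α y w) := by
  simp_rw [hFun_eq hα _ w hw]
  exact (cos_cont (mul_gauss_int ((st_int' hα).comp_mul_left' hw.ne'))).const_mul _

lemma cos_abs (y v : ℝ) : Real.cos (|y| * v) = Real.cos (y * v) := by
  rcases abs_choice y with h | h <;> rw [h]
  rw [neg_mul, Real.cos_neg]

lemma fFun_abs {α : ℝ} (hα : 0 < α) (y w : ℝ) (hw : 0 < w) : fFun α |y| w = fFun α y w := by
  simp_rw [fFun_eq hα _ w hw, cos_abs]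

lemma hFun_abs {α : ℝ} (hα : 0 < α) (y w : ℝ) (hw : 0 < w) : hFun α |y| w = hFun α y w := by
  simp_rw [hFun_eq hα _ w hw, cos_abs]

lemma cos_LL {α β t y : ℝ} (hα : α ∈ Ioo (0:ℝ) 2) (hβ : 0 ≤ β) (ht : 0 ≤ t) (hy : 0 ≤ y) :
    ∫ v : ℝ, Real.cos (y * v) * (Real.exp (-v ^ 2 / 2) * (|v| ^ β * Real.exp (-(t * |v| ^ α)))) =
      2 * (LL α β t y).re := by
  have h := integral_comp_abs (f := fun v : ℝ =>
    Real.cos (y * v) * (Real.exp (-v ^ 2 / 2) * (v ^ β * Real.exp (-(t * v ^ α)))))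
  have e : ∀ v : ℝ, Real.cos (y * v) = Real.cos (y * |v|) := by
    intro v; rw [mul_comm y |v|, cos_abs, mul_comm]
  have h' : ∫ v : ℝ, Real.cos (y * v) * (Real.exp (-v ^ 2 / 2) * (|v| ^ β * Real.exp (-(t * |v| ^ α)))) =
    ∫ v : ℝ, Real.cos (y * |v|) * (Real.exp (-|v| ^ 2 / 2) * (|v| ^ β * Real.exp (-(t * |v| ^ α)))) := by
    refine integral_congr_ae (Eventually.of_forall fun v => ?_)
    simp only
    rw [e v, sq_abs]
  rw [h', h, integral_Ioi_exp]
  congr 1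
  have h2 : ∫ s : ℝ, (GG α β t y s).re = (LL α β t y).re := integral_re (GG_int_real hα hβ ht hy)
  rw [← h2]
  refine integral_congr_ae (Eventually.of_forall fun s => ?_)
  simp only [smul_eq_mul]
  have e3 : GG α β t y s = Complex.exp ((((1 + β) * s - Real.exp (2 * s) / 2 - t * Real.exp (α * s) : ℝ) : ℂ)
     + ((y * Real.exp s : ℝ) : ℂ) * Complex.I) := by
    rw [GG]; congr 1; push_cast; ring
  rw [e3, Complex.exp_add, ← Complex.ofReal_exp, Complex.re_ofReal_mul, Complex.exp_ofReal_mul_I_re,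
    ← Real.exp_mul, ← Real.exp_mul, ← Real.exp_nat_mul]
  have e4 : Real.exp ((1 + β) * s - Real.exp (2 * s) / 2 - t * Real.exp (α * s)) =
    Real.exp s * (Real.exp (-Real.exp (2 * s) / 2) * (Real.exp (s * β) * Real.exp (-(t * Real.exp (s * α))))) := by
    rw [← Real.exp_add, ← Real.exp_add, ← Real.exp_add]; ring_nf
  rw [e4]
  push_cast
  ring

lemma gauss_LL {α y : ℝ} (hα : α ∈ Ioo (0:ℝ) 2) (hy : 0 ≤ y) :
    gauss y = (LL α 0 0 y).re / Real.pi := by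
  have h := cos_LL (β := 0) (t := 0) hα le_rfl le_rfl hy
  have h2 := gauss_cos 0 1 y one_pos
  have h3 : ∀ z : ℝ, gauss (0 - 1 * z) * Real.cos (z * y) = (Real.sqrt (2 * Real.pi))⁻¹ *
    (Real.cos (y * z) * (Real.exp (-z ^ 2 / 2) * (|z| ^ (0:ℝ) * Real.exp (-(0 * |z| ^ α))))) := by
    intro z; rw [gauss, Real.rpow_zero, mul_comm z y]; simp; ring
  simp_rw [h3] at h2
  rw [integral_const_mul, h] at h2
  simp only [zero_mul, Real.cos_zero, inv_one, one_mul, div_one] at h2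
  have hs : Real.sqrt (2 * Real.pi) ≠ 0 := by positivity
  have hs2 : Real.sqrt (2 * Real.pi) * Real.sqrt (2 * Real.pi) = 2 * Real.pi := Real.mul_self_sqrt (by positivity)
  have hp := Real.pi_pos
  have e : Real.exp (-(y ^ 2) / 2) = (Real.sqrt (2 * Real.pi))⁻¹ * (2 * (LL α 0 0 y).re) := by
    rw [h2]
  rw [gauss, e, ← mul_assoc, ← mul_inv, hs2]
  field_simp

lemma rpow_w {α w v : ℝ} (hw : 0 < w) : |w * v| ^ α = w ^ α * |v| ^ α := by
  rw [abs_mul, abs_of_pos hw, Real.mul_rpow hw.le (abs_nonneg _)]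

lemma fFun_LL {α y w : ℝ} (hα : α ∈ Ioo (0:ℝ) 2) (hy : 0 ≤ y) (hw : 0 < w) :
    fFun α y w = (LL α 0 (w ^ α) y).re / Real.pi := by
  have h := cos_LL (β := 0) (t := w ^ α) hα le_rfl (by positivity) hy
  have hp := Real.pi_pos
  rw [fFun_eq hα.1 y w hw]
  simp only [Real.rpow_zero, one_mul] at h
  simp_rw [rpow_w hw]
  rw [h]; field_simp

lemma hFun_LL {α y w : ℝ} (hα : α ∈ Ioo (0:ℝ) 2) (hy : 0 ≤ y) (hw : 0 < w) :
    hFun α y w = α * w ^ α * ((LL α α (w ^ α) y).re / Real.pi) := by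
  have h := cos_LL (β := α) (t := w ^ α) hα hα.1.le (by positivity) hy
  have hp := Real.pi_pos
  rw [hFun_eq hα.1 y w hw]
  simp_rw [rpow_w hw]
  have e : ∀ v : ℝ, Real.cos (y * v) * (Real.exp (-v ^ 2 / 2) * (α * (w ^ α * |v| ^ α) * Real.exp (-(w ^ α * |v| ^ α))))
    = (α * w ^ α) * (Real.cos (y * v) * (Real.exp (-v ^ 2 / 2) * (|v| ^ α * Real.exp (-(w ^ α * |v| ^ α))))) := by
    intro v; ring
  simp_rw [e]
  rw [integral_const_mul, h]; field_simp

lemma gauss_pos (y : ℝ) : 0 < gauss y := by unfold gauss; positivity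

lemma gauss_mono {x y : ℝ} (hx : 0 ≤ x) (hxy : x ≤ y) : gauss y ≤ gauss x := by
  unfold gauss
  gcongr

/-- The hypotheses under which the real-variable part of the argument runs. -/
structure Setup (α c K κ t M R : ℝ) (F H : ℝ → ℝ) : Prop where
  hα : 0 < α
  hc : 0 < c
  hK : 0 < K
  hκ : 0 < κ
  hR : 1 ≤ R
  hRc : 4 * K ≤ c * R ^ 2
  ht : t = κ * Real.exp (-(M ^ 2) / 2)
  htR : t * R ^ 2 ≤ 1
  htM : t * M ≤ 1
  htφ : 2 * K * t ≤ gauss R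
  hM : R + 1 ≤ M
  hexp : ∀ y ≥ M, y ^ (2 + α) * Real.exp (-(y / 2)) ≤ 1
  h1 : ∀ y ≥ 0, |H y| ≤ K
  h2 : ∀ y ≥ 0, |F y - gauss y| ≤ K * t
  h3 : ∀ y ≥ 1, |H y + c * y ^ (-(1 + α))| ≤ K * y ^ (-(1 + α)) * ((y ^ 2)⁻¹ + t)
  h4 : ∀ y ≥ 1, |F y - gauss y - t * c * y ^ (-(1 + α))| ≤
    K * t * y ^ (-(1 + α)) * ((y ^ 2)⁻¹ + t)

section
variable {α c K κ t M R : ℝ} {F H : ℝ → ℝ}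

lemma Setup.tpos (S : Setup α c K κ t M R F H) : 0 < t := by
  rw [S.ht]; have := S.hκ; positivity

lemma Setup.lowR (S : Setup α c K κ t M R F H) {y : ℝ} (hy : R ≤ y) :
    gauss y + c / 2 * t * y ^ (-(1 + α)) ≤ F y := by
  have hR := S.hR
  have htp := S.tpos
  have hc := S.hc
  have hK := S.hK
  have hg : 0 < y ^ (-(1 + α)) := Real.rpow_pos_of_pos (by linarith) _
  have h4 := (abs_le.mp (S.h4 y (by linarith))).1
  have hy2 : R ^ 2 ≤ y ^ 2 := by nlinarith
  have hR2 : 0 < R ^ 2 := by positivity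
  have e1 : (y ^ 2)⁻¹ ≤ (R ^ 2)⁻¹ := by gcongr
  have e2 : t ≤ (R ^ 2)⁻¹ := by
    rw [le_inv_comm₀ htp hR2]
    rw [← one_div, le_div_iff₀ htp]; linarith [S.htR]
  have e3 : K * ((y ^ 2)⁻¹ + t) ≤ c / 2 := by
    calc K * ((y ^ 2)⁻¹ + t) ≤ K * ((R ^ 2)⁻¹ + (R ^ 2)⁻¹) := by gcongr
      _ = (4 * K) / (2 * R ^ 2) := by field_simp; norm_num
      _ ≤ (c * R ^ 2) / (2 * R ^ 2) := div_le_div_of_nonneg_right S.hRc (by positivity)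
      _ = c / 2 := by field_simp
  have e4 : K * t * y ^ (-(1 + α)) * ((y ^ 2)⁻¹ + t) ≤ c / 2 * (t * y ^ (-(1 + α))) := by
    calc _ = K * ((y ^ 2)⁻¹ + t) * (t * y ^ (-(1 + α))) := by ring
      _ ≤ _ := by gcongr
  linarith

lemma Setup.low (S : Setup α c K κ t M R F H) {y : ℝ} (hy : 0 ≤ y) : gauss y / 2 ≤ F y := by
  have hg := gauss_pos y
  rcases le_total y R with h | h
  · have h2 := (abs_le.mp (S.h2 y hy)).1
    have := gauss_mono hy h
    linarith [S.htφ]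
  · have h4 := S.lowR h
    have hR := S.hR
    have htp := S.tpos
    have hc := S.hc
    have : 0 < c / 2 * t * y ^ (-(1 + α)) := by
      have : 0 < y ^ (-(1 + α)) := Real.rpow_pos_of_pos (by linarith) _
      positivity
    linarith

lemma Setup.Fpos (S : Setup α c K κ t M R F H) {y : ℝ} (hy : 0 ≤ y) : 0 < F y := by
  linarith [S.low hy, gauss_pos y]

lemma Setup.reg1 (S : Setup α c K κ t M R F H) {y : ℝ} (hy : 0 ≤ y) (hy2 : y ≤ M - 1) :
    H y ^ 2 / F y ≤ 2 * K ^ 2 * Real.sqrt (2 * Real.pi) * κ * (t⁻¹ * M ^ (-(2 + α))) := by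
  have hM0 : 0 < M := by linarith [S.hM, S.hR]
  have hM2 : 2 ≤ M := by linarith [S.hM, S.hR]
  have htp := S.tpos
  have hκ := S.hκ
  have hs : 0 < Real.sqrt (2 * Real.pi) := by positivity
  have h1 : H y ^ 2 ≤ K ^ 2 := sq_le_sq' (abs_le.mp (S.h1 y hy)).1 (abs_le.mp (S.h1 y hy)).2
  have h2 : gauss (M - 1) / 2 ≤ F y := by linarith [S.low hy, gauss_mono hy hy2]
  have hp : 0 < M ^ (2 + α) := by positivity
  have h3 : (Real.sqrt (2 * Real.pi))⁻¹ * κ⁻¹ * t * M ^ (2 + α) ≤ gauss (M - 1) := by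
    have e1 := S.hexp M le_rfl
    rw [Real.exp_neg, ← div_eq_mul_inv, div_le_one (Real.exp_pos _)] at e1
    have e2 : Real.exp (M / 2) ≤ Real.exp (M - 1 / 2) := Real.exp_le_exp.mpr (by linarith)
    rw [gauss, S.ht]
    have e3 : Real.exp (-((M - 1) ^ 2) / 2) = Real.exp (-(M ^ 2) / 2) * Real.exp (M - 1 / 2) := by
      rw [← Real.exp_add]; ring_nf
    rw [e3]
    calc _ = (Real.sqrt (2 * Real.pi))⁻¹ * (Real.exp (-(M ^ 2) / 2) * M ^ (2 + α)) := by
          field_simp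
      _ ≤ _ := by gcongr; linarith
  have h4 : 0 < (Real.sqrt (2 * Real.pi))⁻¹ * κ⁻¹ * t * M ^ (2 + α) := by positivity
  calc H y ^ 2 / F y ≤ K ^ 2 / (((Real.sqrt (2 * Real.pi))⁻¹ * κ⁻¹ * t * M ^ (2 + α)) / 2) := by
        gcongr
        linarith
    _ = _ := by
        rw [Real.rpow_neg hM0.le]
        field_simp

lemma Setup.eps (S : Setup α c K κ t M R F H) {y : ℝ} (hy : M ≤ y) :
    (y ^ 2)⁻¹ + t ≤ 2 / M := by
  have hM0 : 0 < M := by linarith [S.hM, S.hR]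
  have hM2 : 2 ≤ M := by linarith [S.hM, S.hR]
  have e1 : (y ^ 2)⁻¹ ≤ 1 / M := by
    rw [← one_div]
    apply one_div_le_one_div_of_le hM0
    nlinarith
  have e2 : t ≤ 1 / M := by rw [le_div_iff₀ hM0]; exact S.htM
  calc _ ≤ 1 / M + 1 / M := add_le_add e1 e2
    _ = 2 / M := by ring

lemma Setup.Habs (S : Setup α c K κ t M R F H) {y : ℝ} (hy : R ≤ y) :
    |H y| ≤ (c + 2 * K) * y ^ (-(1 + α)) := by
  have hR := S.hR
  have htp := S.tpos
  have hK := S.hK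
  have hc := S.hc
  have hy1 : 1 ≤ y := by linarith
  have hg : 0 < y ^ (-(1 + α)) := Real.rpow_pos_of_pos (by linarith) _
  have h3 := S.h3 y hy1
  have e1 : (y ^ 2)⁻¹ ≤ 1 := inv_le_one_of_one_le₀ (by nlinarith)
  have e2 : t ≤ 1 := (le_mul_of_one_le_right htp.le (one_le_pow₀ hR)).trans S.htR
  have e3 : K * y ^ (-(1 + α)) * ((y ^ 2)⁻¹ + t) ≤ K * y ^ (-(1 + α)) * 2 := by
    gcongr; linarith
  have e4 : |H y| ≤ |H y + c * y ^ (-(1 + α))| + c * y ^ (-(1 + α)) := by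
    have := abs_sub (H y + c * y ^ (-(1 + α))) (c * y ^ (-(1 + α)))
    rwa [add_sub_cancel_right, abs_of_pos (a := c * y ^ (-(1 + α))) (by positivity)] at this
  linarith

lemma Setup.reg2 (S : Setup α c K κ t M R F H) {y : ℝ} (hy : M - 1 ≤ y) :
    H y ^ 2 / F y ≤ (c + 2 * K) ^ 2 * (2 / c) * 2 ^ (1 + α) * (t⁻¹ * M ^ (-(1 + α))) := by
  have hM0 : 0 < M := by linarith [S.hM, S.hR]
  have hM2 : 2 ≤ M := by linarith [S.hM, S.hR]
  have htp := S.tpos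
  have hK := S.hK
  have hc := S.hc
  have hα := S.hα
  have hRy : R ≤ y := by linarith [S.hM]
  have hg : 0 < y ^ (-(1 + α)) := Real.rpow_pos_of_pos (by linarith) _
  have h1 : H y ^ 2 ≤ ((c + 2 * K) * y ^ (-(1 + α))) ^ 2 :=
    sq_le_sq' (abs_le.mp (S.Habs hRy)).1 (abs_le.mp (S.Habs hRy)).2
  have h2 : c / 2 * t * y ^ (-(1 + α)) ≤ F y := by linarith [S.lowR hRy, gauss_pos y]
  have h3 : y ^ (-(1 + α)) ≤ 2 ^ (1 + α) * M ^ (-(1 + α)) := by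
    calc y ^ (-(1 + α)) ≤ (M / 2) ^ (-(1 + α)) :=
          Real.rpow_le_rpow_of_nonpos (by positivity) (by linarith) (by linarith)
      _ = _ := by
        rw [Real.div_rpow hM0.le (by norm_num), Real.rpow_neg (x := 2) (by norm_num)]
        field_simp
  calc H y ^ 2 / F y ≤ ((c + 2 * K) * y ^ (-(1 + α))) ^ 2 / (c / 2 * t * y ^ (-(1 + α))) := by
        gcongr
    _ = (c + 2 * K) ^ 2 * (2 / c) * t⁻¹ * y ^ (-(1 + α)) := by field_simp
    _ ≤ (c + 2 * K) ^ 2 * (2 / c) * t⁻¹ * (2 ^ (1 + α) * M ^ (-(1 + α))) := by gcongr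
    _ = _ := by ring

lemma Setup.reg3 (S : Setup α c K κ t M R F H) {y : ℝ} (hy : M + 1 ≤ y) :
    |H y ^ 2 / F y - c * t⁻¹ * y ^ (-(1 + α))| ≤
      (4 * K * (3 * c + 2 * K) / c + 2 * κ⁻¹) * (t⁻¹ * M⁻¹ * y ^ (-(1 + α))) := by
  have hM0 : 0 < M := by linarith [S.hM, S.hR]
  have hM2 : 2 ≤ M := by linarith [S.hM, S.hR]
  have htp := S.tpos
  have hK := S.hK
  have hc := S.hc
  have hα := S.hα
  have hκ := S.hκ
  have hRy : R ≤ y := by linarith [S.hM]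
  have hy1 : 1 ≤ y := by linarith
  have hy0 : 0 < y := by linarith
  have hF := S.Fpos hy0.le
  have hHa := S.Habs hRy
  have hg : 0 < y ^ (-(1 + α)) := Real.rpow_pos_of_pos (by linarith) _
  have h2 : c / 2 * t * y ^ (-(1 + α)) ≤ F y := by linarith [S.lowR hRy, gauss_pos y]
  have h3 := S.h3 y hy1
  have h4 := S.h4 y hy1
  have hφ : gauss y ≤ t * (κ⁻¹ * (M⁻¹ * y ^ (-(1 + α)))) := by
    have e1 := S.hexp y (by linarith)
    have e0 : y ^ (2 + α) = y * y ^ (1 + α) := by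
      rw [← Real.rpow_one_add' hy0.le (by linarith)]; ring_nf
    have e2 : Real.exp (-(y / 2)) ≤ y⁻¹ * y ^ (-(1 + α)) := by
      rw [Real.rpow_neg hy0.le, ← mul_inv, ← e0, ← one_div,
        le_div_iff₀ (by positivity), mul_comm]
      exact e1
    have e3 : y⁻¹ ≤ M⁻¹ := by gcongr; linarith
    have e4 : (Real.sqrt (2 * Real.pi))⁻¹ ≤ 1 := by
      apply inv_le_one_of_one_le₀
      rw [Real.one_le_sqrt]; linarith [Real.pi_gt_three]
    rw [gauss, S.ht]
    calc _ ≤ 1 * (Real.exp (-(M ^ 2) / 2) * Real.exp (-(y / 2))) := by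
          rw [← Real.exp_add]
          gcongr
          nlinarith
      _ ≤ 1 * (Real.exp (-(M ^ 2) / 2) * (M⁻¹ * y ^ (-(1 + α)))) := by
          gcongr
          exact e2.trans (by gcongr)
      _ = _ := by field_simp
  have heps := S.eps (y := y) (by linarith)
  set g := y ^ (-(1 + α)) with hgdef
  set ε := (y ^ 2)⁻¹ + t with hε
  have hε0 : 0 < ε := by positivity
  have a1 : |H y ^ 2 - (c * g) ^ 2| ≤ K * g * ε * ((2 * c + 2 * K) * g) := by
    rw [show H y ^ 2 - (c * g) ^ 2 = (H y + c * g) * (H y - c * g) by ring, abs_mul]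
    have : |H y - c * g| ≤ (2 * c + 2 * K) * g := by
      have := abs_sub (H y) (c * g)
      rw [abs_of_pos (a := c * g) (by positivity)] at this
      linarith
    gcongr
  have a2 : |F y - t * c * g| ≤ gauss y + K * t * g * ε := by
    have := abs_add_le (F y - gauss y - t * c * g) (gauss y)
    rw [abs_of_pos (gauss_pos y), show F y - gauss y - t * c * g + gauss y = F y - t * c * g by ring] at this
    linarith
  have a3 : H y ^ 2 / F y - c * t⁻¹ * g =
      ((H y ^ 2 - (c * g) ^ 2) - c * t⁻¹ * g * (F y - t * c * g)) / F y := by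
    field_simp; ring
  rw [a3, abs_div, abs_of_pos hF]
  have a4 : |(H y ^ 2 - (c * g) ^ 2) - c * t⁻¹ * g * (F y - t * c * g)| ≤
      K * g * (2 / M) * ((2 * c + 2 * K) * g) + c * t⁻¹ * g * (t * (κ⁻¹ * (M⁻¹ * g)) + K * t * g * (2 / M)) := by
    refine (abs_sub _ _).trans ?_
    rw [abs_mul, abs_of_pos (a := c * t⁻¹ * g) (by positivity)]
    have b1 : K * g * ε * ((2 * c + 2 * K) * g) ≤ K * g * (2 / M) * ((2 * c + 2 * K) * g) := by gcongr
    have b2 : gauss y + K * t * g * ε ≤ t * (κ⁻¹ * (M⁻¹ * g)) + K * t * g * (2 / M) := by gcongr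
    have b3 := a2.trans b2
    refine add_le_add (a1.trans b1) ?_
    gcongr
  calc _ ≤ (K * g * (2 / M) * ((2 * c + 2 * K) * g) + c * t⁻¹ * g * (t * (κ⁻¹ * (M⁻¹ * g)) + K * t * g * (2 / M))) /
        (c / 2 * t * g) := by gcongr
    _ = _ := by
      field_simp
      ring

end

section
variable {α c K κ t M R : ℝ} {F H : ℝ → ℝ}

/-- constants of the three regions -/
def C1 (K κ : ℝ) : ℝ := 2 * K ^ 2 * Real.sqrt (2 * Real.pi) * κ
def C2 (α c K : ℝ) : ℝ := (c + 2 * K) ^ 2 * (2 / c) * 2 ^ (1 + α)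
def C3 (c K κ : ℝ) : ℝ := 4 * K * (3 * c + 2 * K) / c + 2 * κ⁻¹

lemma Setup.integral (S : Setup α c K κ t M R F H) (hFm : Measurable F) (hHm : Measurable H) :
    |(∫ y in Ioi (0:ℝ), H y ^ 2 / F y) - c * t⁻¹ * (M ^ (-α) / α)| ≤
      (C1 K κ + 2 * (C2 α c K + c) + C3 c K κ / α) * (t⁻¹ * M ^ (-(1 + α))) := by
  have hM0 : 0 < M := by linarith [S.hM, S.hR]
  have hM2 : 2 ≤ M := by linarith [S.hM, S.hR]
  have htp := S.tpos
  have hK := S.hK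
  have hc := S.hc
  have hα := S.hα
  have hκ := S.hκ
  have hC1 : 0 ≤ C1 K κ := by unfold C1; positivity
  have hC2 : 0 ≤ C2 α c K := by unfold C2; positivity
  have hC3 : 0 ≤ C3 c K κ := by unfold C3; positivity
  have hgi : IntegrableOn (fun y : ℝ => y ^ (-(1 + α))) (Ioi M) :=
    integrableOn_Ioi_rpow_of_lt (by linarith) hM0
  have hgv : ∫ y in Ioi M, y ^ (-(1 + α)) = M ^ (-α) / α := by
    rw [integral_Ioi_rpow_of_lt (by linarith) hM0, show -(1 + α) + 1 = -α by ring, neg_div_neg_eq]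
  set A : ℝ := C1 K κ * (t⁻¹ * M ^ (-(2 + α))) with hA
  set B : ℝ := (C2 α c K + c) * (t⁻¹ * M ^ (-(1 + α))) with hB
  set E : ℝ := C3 c K κ * (t⁻¹ * M⁻¹) with hE
  set q : ℝ → ℝ := (Ioi (0:ℝ)).indicator (fun y => H y ^ 2 / F y) with hq
  set m : ℝ → ℝ := (Ioi M).indicator (fun y => c * t⁻¹ * y ^ (-(1 + α))) with hm
  set Q1 : ℝ → ℝ := (Ioc 0 M).indicator (fun _ => A)
  set Q2 : ℝ → ℝ := (Ioc (M - 1) (M + 1)).indicator (fun _ => B)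
  set Q3 : ℝ → ℝ := (Ioi M).indicator (fun y => E * y ^ (-(1 + α)))
  have hA0 : 0 ≤ A := by positivity
  have hB0 : 0 ≤ B := by positivity
  have hE0 : 0 ≤ E := by positivity
  have i1 : Integrable Q1 := (integrable_indicator_iff measurableSet_Ioc).mpr
    (integrableOn_const (by simp))
  have i2 : Integrable Q2 := (integrable_indicator_iff measurableSet_Ioc).mpr
    (integrableOn_const (by simp))
  have i3 : Integrable Q3 := (integrable_indicator_iff measurableSet_Ioi).mpr (hgi.const_mul E)
  have im : Integrable m := (integrable_indicator_iff measurableSet_Ioi).mpr (hgi.const_mul _)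
  have v1 : ∫ y, Q1 y = M * A := by
    rw [integral_indicator measurableSet_Ioc, setIntegral_const]; simp [hM0.le]
  have v2 : ∫ y, Q2 y = 2 * B := by
    rw [integral_indicator measurableSet_Ioc, setIntegral_const]
    simp only [Real.volume_real_Ioc, smul_eq_mul]
    rw [max_eq_left (by linarith)]; ring
  have v3 : ∫ y, Q3 y = E * (M ^ (-α) / α) := by
    rw [integral_indicator measurableSet_Ioi, integral_const_mul, hgv]
  have vm : ∫ y, m y = c * t⁻¹ * (M ^ (-α) / α) := by
    rw [integral_indicator measurableSet_Ioi, integral_const_mul, hgv]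
  have vq : ∫ y, q y = ∫ y in Ioi (0:ℝ), H y ^ 2 / F y := integral_indicator measurableSet_Ioi
  have n1 : ∀ y, 0 ≤ Q1 y := fun y => indicator_nonneg (fun _ _ => hA0) y
  have n2 : ∀ y, 0 ≤ Q2 y := fun y => indicator_nonneg (fun _ _ => hB0) y
  have n3 : ∀ y, 0 ≤ Q3 y := fun y => indicator_nonneg (fun x hx => by
    have : 0 < x := hM0.trans hx
    positivity) y
  have key : ∀ y, ‖q y - m y‖ ≤ Q1 y + Q2 y + Q3 y := by
    intro y
    have N1 := n1 y
    have N2 := n2 y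
    have N3 := n3 y
    rw [Real.norm_eq_abs]
    rcases le_or_gt y 0 with h0 | h0
    · have eq : q y = 0 := indicator_of_notMem (by simpa using h0) _
      have em : m y = 0 := indicator_of_notMem (by simp; linarith) _
      rw [eq, em]; simp; linarith
    have eq : q y = H y ^ 2 / F y := indicator_of_mem (show y ∈ Ioi (0:ℝ) from h0) _
    have hF := S.Fpos h0.le
    rcases le_or_gt y (M - 1) with h1 | h1
    · have em : m y = 0 := indicator_of_notMem (by simp; linarith) _
      have e1 : Q1 y = A := indicator_of_mem (show y ∈ Ioc 0 M from ⟨h0, by linarith⟩) _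
      rw [eq, em, sub_zero, abs_of_nonneg (by positivity)]
      have := S.reg1 h0.le h1
      rw [e1]
      have : H y ^ 2 / F y ≤ A := this
      linarith
    rcases le_or_gt y (M + 1) with h2 | h2
    · have e2 : Q2 y = B := indicator_of_mem (show y ∈ Ioc (M - 1) (M + 1) from ⟨h1, h2⟩) _
      have r2 := S.reg2 h1.le
      have hm0 : 0 ≤ m y := indicator_nonneg (fun x hx => by
        have : 0 < x := hM0.trans hx
        positivity) y
      have hm1 : m y ≤ c * (t⁻¹ * M ^ (-(1 + α))) := by
        by_cases hy : M < y
        · have em : m y = c * t⁻¹ * y ^ (-(1 + α)) := indicator_of_mem (show y ∈ Ioi M from hy) _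
          have : y ^ (-(1 + α)) ≤ M ^ (-(1 + α)) :=
            Real.rpow_le_rpow_of_nonpos hM0 hy.le (by linarith)
          rw [em, mul_assoc]; gcongr
        · have em : m y = 0 := indicator_of_notMem (by simpa using hy) _
          rw [em]; positivity
      have r2' : H y ^ 2 / F y ≤ C2 α c K * (t⁻¹ * M ^ (-(1 + α))) := r2
      have hq0 : 0 ≤ H y ^ 2 / F y := by positivity
      have hs : |q y - m y| ≤ B := by
        rw [eq, hB, add_mul]
        have : 0 ≤ C2 α c K * (t⁻¹ * M ^ (-(1 + α))) := by positivity
        have : 0 ≤ c * (t⁻¹ * M ^ (-(1 + α))) := by positivity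
        rw [abs_le]; constructor <;> linarith
      linarith
    · have hyM : y ∈ Ioi M := by simp; linarith
      have em : m y = c * t⁻¹ * y ^ (-(1 + α)) := indicator_of_mem hyM _
      have e3 : Q3 y = E * y ^ (-(1 + α)) := indicator_of_mem hyM _
      have r3 := S.reg3 h2.le
      have r3' : |q y - m y| ≤ E * y ^ (-(1 + α)) := by
        rw [eq, em]; refine r3.trans (le_of_eq ?_); rw [hE, C3]; ring
      linarith
  have iQ : Integrable (fun y => Q1 y + Q2 y + Q3 y) := (i1.add i2).add i3
  have hqm : AEStronglyMeasurable q := by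
    refine Measurable.aestronglyMeasurable ?_
    exact ((hHm.pow_const 2).div hFm).indicator measurableSet_Ioi
  have id : Integrable (fun y => q y - m y) :=
    iQ.mono' (hqm.sub im.aestronglyMeasurable) (Eventually.of_forall key)
  have iq : Integrable q := by
    have := id.add im
    refine this.congr (Eventually.of_forall fun y => ?_)
    simp
  rw [← vq, ← vm, ← integral_sub iq im, ← Real.norm_eq_abs]
  refine (norm_integral_le_of_norm_le iQ (Eventually.of_forall key)).trans (le_of_eq ?_)
  rw [integral_add (f := fun y => Q1 y + Q2 y) (i1.add i2) i3, integral_add i1 i2, v1, v2, v3]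
  have p1 : M * M ^ (-(2 + α)) = M ^ (-(1 + α)) := by
    rw [← Real.rpow_one_add' hM0.le (by linarith)]; ring_nf
  have p2 : M⁻¹ * M ^ (-α) = M ^ (-(1 + α)) := by
    rw [← Real.rpow_neg_one, ← Real.rpow_add hM0]; ring_nf
  rw [hA, hB, hE]
  calc _ = C1 K κ * t⁻¹ * (M * M ^ (-(2 + α))) + 2 * ((C2 α c K + c) * (t⁻¹ * M ^ (-(1 + α))))
      + C3 c K κ / α * t⁻¹ * (M⁻¹ * M ^ (-α)) := by ring
    _ = _ := by rw [p1, p2]; ring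

end

/-- normalised `h` -/
def HH (α w y : ℝ) : ℝ := hFun α y w / (α * w ^ α)

lemma half_rpow {y b : ℝ} (hy : 0 < y) : (y / 2) ^ (-b) = 2 ^ b * y ^ (-b) := by
  rw [Real.div_rpow hy.le (by norm_num), Real.rpow_neg (x := 2) (by norm_num)]
  field_simp

def KK (α : ℝ) : ℝ := |DC α| + 1 + Real.Gamma (3 + α) * 2 ^ (3 + α) +
  Real.Gamma (1 + 2 * α) * 2 ^ (1 + 2 * α)

lemma KK_pos {α : ℝ} (hα : α ∈ Ioo (0:ℝ) 2) : 0 < KK α := by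
  have := hα.1
  have h1 : 0 < Real.Gamma (3 + α) := Real.Gamma_pos_of_pos (by linarith)
  have h2 : 0 < Real.Gamma (1 + 2 * α) := Real.Gamma_pos_of_pos (by linarith)
  unfold KK; positivity

lemma re_div_pi (z : ℂ) : |z.re / Real.pi| ≤ ‖z‖ := by
  rw [abs_div, abs_of_pos Real.pi_pos]
  refine (div_le_self (abs_nonneg _) (by linarith [Real.pi_gt_three])).trans (Complex.abs_re_le_norm z)

lemma KK_asymp {α t y : ℝ} (hα : α ∈ Ioo (0:ℝ) 2) (ht : 0 ≤ t) (hy : 1 ≤ y) :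
    Real.Gamma (3 + α) * (y / 2) ^ (-(3 + α)) + t * (Real.Gamma (1 + 2 * α) * (y / 2) ^ (-(1 + 2 * α)))
     ≤ KK α * y ^ (-(1 + α)) * ((y ^ 2)⁻¹ + t) := by
  have h0 := hα.1
  have h1 : 0 < Real.Gamma (3 + α) := Real.Gamma_pos_of_pos (by linarith)
  have h2 : 0 < Real.Gamma (1 + 2 * α) := Real.Gamma_pos_of_pos (by linarith)
  have hy0 : 0 < y := by linarith
  rw [half_rpow hy0, half_rpow hy0]
  have e1 : y ^ (-(3 + α)) = y ^ (-(1 + α)) * (y ^ 2)⁻¹ := by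
    rw [← Real.rpow_natCast, ← Real.rpow_neg hy0.le, ← Real.rpow_add hy0]
    congr 1; push_cast; ring
  have e2 : y ^ (-(1 + 2 * α)) ≤ y ^ (-(1 + α)) :=
    Real.rpow_le_rpow_of_exponent_le hy (by linarith)
  have hg : 0 < y ^ (-(1 + α)) := by positivity
  have hA : 0 < Real.Gamma (3 + α) * 2 ^ (3 + α) := by positivity
  have hB : 0 < Real.Gamma (1 + 2 * α) * 2 ^ (1 + 2 * α) := by positivity
  have hK1 : Real.Gamma (3 + α) * 2 ^ (3 + α) ≤ KK α := by
    unfold KK; linarith [abs_nonneg (DC α)]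
  have hK2 : Real.Gamma (1 + 2 * α) * 2 ^ (1 + 2 * α) ≤ KK α := by
    unfold KK; linarith [abs_nonneg (DC α)]
  rw [e1]
  calc _ = (Real.Gamma (3 + α) * 2 ^ (3 + α)) * (y ^ (-(1 + α)) * (y ^ 2)⁻¹) +
      (Real.Gamma (1 + 2 * α) * 2 ^ (1 + 2 * α)) * (t * y ^ (-(1 + 2 * α))) := by ring
    _ ≤ KK α * (y ^ (-(1 + α)) * (y ^ 2)⁻¹) + KK α * (t * y ^ (-(1 + α))) := by
      have := KK_pos hα
      gcongr
    _ = _ := by ring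

lemma HH_LL {α y w : ℝ} (hα : α ∈ Ioo (0:ℝ) 2) (hy : 0 ≤ y) (hw : 0 < w) :
    HH α w y = (LL α α (w ^ α) y).re / Real.pi := by
  have h0 := hα.1
  have : 0 < w ^ α := by positivity
  rw [HH, hFun_LL hα hy hw]; field_simp

lemma mkSetup {α κ t M R w : ℝ} (hα : α ∈ Ioo (0:ℝ) 2) (hw : 0 < w) (hwt : w ^ α = t)
    (hκ : 0 < κ) (hR : 1 ≤ R) (hRc : 4 * KK α ≤ cc0 α * R ^ 2)
    (ht : t = κ * Real.exp (-(M ^ 2) / 2)) (htR : t * R ^ 2 ≤ 1) (htM : t * M ≤ 1)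
    (htφ : 2 * KK α * t ≤ gauss R) (hM : R + 1 ≤ M)
    (hexp : ∀ y ≥ M, y ^ (2 + α) * Real.exp (-(y / 2)) ≤ 1) :
    Setup α (cc0 α) (KK α) κ t M R (fun y => fFun α y w) (HH α w) := by
  have h0 := hα.1
  have ht0 : 0 < t := by rw [← hwt]; positivity
  have hDC : DC α ≤ KK α := by
    have h1 : 0 < Real.Gamma (3 + α) := Real.Gamma_pos_of_pos (by linarith)
    have h2 : 0 < Real.Gamma (1 + 2 * α) := Real.Gamma_pos_of_pos (by linarith)
    have h3 : 0 < Real.Gamma (3 + α) * 2 ^ (3 + α) := by positivity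
    have h4 : 0 < Real.Gamma (1 + 2 * α) * 2 ^ (1 + 2 * α) := by positivity
    unfold KK; linarith [le_abs_self (DC α)]
  refine ⟨h0, cc0_pos hα, KK_pos hα, hκ, hR, hRc, ht, htR, htM, htφ, hM, hexp, ?_, ?_, ?_, ?_⟩
  · intro y hy
    rw [HH_LL hα hy hw, hwt]
    exact (re_div_pi _).trans ((H_crude hα ht0.le hy).trans hDC)
  · intro y hy
    rw [fFun_LL hα hy hw, gauss_LL hα hy, hwt, ← sub_div, ← Complex.sub_re]
    refine (re_div_pi _).trans ((F_crude hα ht0.le hy).trans ?_)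
    rw [mul_comm]; gcongr
  · intro y hy
    have hp := Real.pi_pos
    have e : HH α w y + cc0 α * y ^ (-(1 + α)) = (LL α α t y - EE α y).re / Real.pi := by
      rw [HH_LL hα (by linarith) hw, hwt, Complex.sub_re, EE_re]
      field_simp; ring
    rw [e]
    exact (re_div_pi _).trans ((H_asymp hα ht0.le (by linarith)).trans (KK_asymp hα ht0.le hy))
  · intro y hy
    have hp := Real.pi_pos
    have e : fFun α y w - gauss y - t * cc0 α * y ^ (-(1 + α)) =
        (LL α 0 t y - LL α 0 0 y + t * EE α y).re / Real.pi := by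
      rw [fFun_LL hα (by linarith) hw, gauss_LL hα (by linarith), hwt, Complex.add_re, Complex.sub_re,
        Complex.re_ofReal_mul, EE_re]
      field_simp; ring
    rw [e]
    refine (re_div_pi _).trans ((F_asymp hα ht0.le (by linarith)).trans ?_)
    have := mul_le_mul_of_nonneg_left (KK_asymp hα ht0.le hy) ht0.le
    refine le_trans (le_of_eq ?_) (this.trans (le_of_eq ?_)) <;> ring

/-- the conclusion for large `M` -/
lemma eventually_bound {α κ : ℝ} (hα : α ∈ Ioo (0:ℝ) 2) (hκ : 0 < κ) :
    ∃ C > (0:ℝ), ∀ᶠ M : ℝ in atTop, ∀ w > (0:ℝ), w ^ α = κ * Real.exp (-(M ^ 2) / 2) →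
      |(∫ y in Ioi (0:ℝ), HH α w y ^ 2 / fFun α y w) - cc0 α * (w ^ α)⁻¹ * (M ^ (-α) / α)| ≤
        C * ((w ^ α)⁻¹ * M ^ (-(1 + α))) := by
  have h0 := hα.1
  have hK := KK_pos hα
  have hc := cc0_pos hα
  set R : ℝ := 1 + 4 * KK α / cc0 α with hRdef
  have hR : 1 ≤ R := by rw [hRdef]; have : 0 < 4 * KK α / cc0 α := by positivity
                        linarith
  have hRc : 4 * KK α ≤ cc0 α * R ^ 2 := by
    have e1 : R ≤ R ^ 2 := by nlinarith
    have e2 : 4 * KK α / cc0 α ≤ R ^ 2 := by linarith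
    rw [div_le_iff₀ hc] at e2; linarith
  have hC1 : 0 < C1 (KK α) κ := by unfold C1; positivity
  have hC2 : 0 < C2 α (cc0 α) (KK α) := by unfold C2; positivity
  have hC3 : 0 < C3 (cc0 α) (KK α) κ := by unfold C3; positivity
  refine ⟨C1 (KK α) κ + 2 * (C2 α (cc0 α) (KK α) + cc0 α) + C3 (cc0 α) (KK α) κ / α, by positivity, ?_⟩
  have T1 := (tendsto_rpow_mul_exp_neg_mul_atTop_nhds_zero (2 + α) (1 / 2) (by norm_num)).eventually
    (ge_mem_nhds (show (0:ℝ) < 1 by norm_num))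
  obtain ⟨M1, hM1⟩ := eventually_atTop.mp T1
  have hεp : 0 < min 1 (min (1 / R ^ 2) (gauss R / (2 * KK α))) / κ := by
    have := gauss_pos R
    positivity
  have T2 := (tendsto_rpow_mul_exp_neg_mul_atTop_nhds_zero 1 (1 / 2) (by norm_num)).eventually
    (ge_mem_nhds hεp)
  filter_upwards [T2, eventually_ge_atTop (R + 1), eventually_ge_atTop M1] with M hM2 hMR hMM w hw hwt
  have hM0 : 1 ≤ M := by linarith
  rw [le_div_iff₀ hκ, Real.rpow_one] at hM2
  have htM : w ^ α * M ≤ min 1 (min (1 / R ^ 2) (gauss R / (2 * KK α))) := by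
    refine le_trans ?_ hM2
    rw [hwt]
    have : Real.exp (-(M ^ 2) / 2) ≤ Real.exp (-(1 / 2) * M) := Real.exp_le_exp.mpr (by nlinarith)
    calc _ = κ * M * Real.exp (-(M ^ 2) / 2) := by ring
      _ ≤ κ * M * Real.exp (-(1 / 2) * M) := by gcongr
      _ = _ := by ring
  have hwp : 0 < w ^ α := by positivity
  have htt : w ^ α ≤ min 1 (min (1 / R ^ 2) (gauss R / (2 * KK α))) :=
    (le_mul_of_one_le_right hwp.le hM0).trans htM
  have a1 := htM.trans (min_le_left _ _)
  have a2 := htt.trans ((min_le_right _ _).trans (min_le_left _ _))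
  have a3 := htt.trans ((min_le_right _ _).trans (min_le_right _ _))
  rw [le_div_iff₀ (by positivity)] at a2 a3
  have S := mkSetup (R := R) hα hw rfl hκ hR hRc hwt a2 a1 (by linarith) hMR (by
    intro y hy
    have := hM1 y (by linarith)
    rwa [show -(1 / 2) * y = -(y / 2) by ring] at this)
  exact S.integral (fFun_cont h0 w hw).measurable ((hFun_cont h0 w hw).div_const _).measurable

/-- asymptotics of `∫ h_α² / f_α`. -/
theorem statement11 (σ δ α : ℝ) (hσ : 0 < σ) (hδ : 0 < δ) (hα : α ∈ Set.Ioo (0 : ℝ) 2) :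
    ∃ C > (0 : ℝ), ∃ N : ℕ, ∀ n ≥ N,
      |(∫ y : ℝ, hFun α y (wn n σ δ α) ^ 2 / fFun α y (wn n σ δ α))
          - α ^ 2 * kappa0 σ δ α / ((n : ℝ) ^ (1 - α / 2) * Real.log n ^ (α / 2))| ≤
        C * (1 / ((n : ℝ) ^ (1 - α / 2) * Real.log n ^ (α / 2))) *
          (Real.log (Real.log n) / Real.log n ^ (min (1 / 4 : ℝ) α)) := by
  have h0 := hα.1
  have h2 := hα.2
  have hκ : 0 < (δ / σ) ^ α := by positivity
  set κ := (δ / σ) ^ α with hκdef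
  obtain ⟨C, hC, hev⟩ := eventually_bound hα hκ
  have hlog : Tendsto (fun n : ℕ => Real.log (n : ℝ)) atTop atTop :=
    Real.tendsto_log_atTop.comp tendsto_natCast_atTop_atTop
  have hMt : Tendsto (fun n : ℕ => Real.sqrt ((2 - α) * Real.log n)) atTop atTop :=
    Real.tendsto_sqrt_atTop.comp (hlog.const_mul_atTop (by linarith))
  have hs : 0 < 2 - α := by linarith
  set D : ℝ := 2 * α ^ 2 * C * κ * (2 - α) ^ (-(1 + α) / 2) with hD
  have hD0 : 0 < D := by positivity
  have hall : ∀ᶠ n : ℕ in atTop,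
      |(∫ y : ℝ, hFun α y (wn n σ δ α) ^ 2 / fFun α y (wn n σ δ α))
          - α ^ 2 * kappa0 σ δ α / ((n : ℝ) ^ (1 - α / 2) * Real.log n ^ (α / 2))| ≤
        D * (1 / ((n : ℝ) ^ (1 - α / 2) * Real.log n ^ (α / 2))) *
          (Real.log (Real.log n) / Real.log n ^ (min (1 / 4 : ℝ) α)) := by
    filter_upwards [hMt.eventually hev, hlog.eventually_ge_atTop (Real.exp 1),
      eventually_ge_atTop 1] with n hn hL hn1
    have hnp : (0:ℝ) < n := by exact_mod_cast hn1
    set L := Real.log (n:ℝ) with hLdef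
    set w := wn n σ δ α with hwdef
    set M := Real.sqrt ((2 - α) * L) with hMdef
    have hL1 : 1 ≤ L := le_trans (by linarith [Real.add_one_le_exp (1:ℝ)]) hL
    have hL0 : 0 < L := by linarith
    have hw : 0 < w := by rw [hwdef, wn]; positivity
    set X := (n:ℝ) ^ (1 - α / 2) with hX
    have hX0 : 0 < X := by positivity
    have hM2 : M ^ 2 = (2 - α) * L := Real.sq_sqrt (by positivity)
    have hexpX : Real.exp (-(M ^ 2) / 2) = X⁻¹ := by
      rw [hM2, hX, Real.rpow_def_of_pos hnp, ← Real.exp_neg, ← hLdef]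
      congr 1; ring
    have hwt : w ^ α = κ * X⁻¹ := by
      rw [hwdef, wn, mul_div_assoc, Real.mul_rpow (by positivity) (by positivity), ← Real.rpow_mul hnp.le,
        hX, ← Real.rpow_neg hnp.le, mul_comm]
      congr 2; field_simp; ring
    have hb := hn w hw (by rw [hwt, hexpX])
    have hMa : M ^ (-α) = (2 - α) ^ (-(α / 2)) * L ^ (-(α / 2)) := by
      rw [hMdef, Real.sqrt_eq_rpow, ← Real.rpow_mul (by positivity), Real.mul_rpow hs.le hL0.le]
      congr 2 <;> ring
    have hMb : M ^ (-(1 + α)) = (2 - α) ^ (-(1 + α) / 2) * (L ^ (-(α / 2)) * L ^ (-(1 / 2 : ℝ))) := by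
      rw [hMdef, Real.sqrt_eq_rpow, ← Real.rpow_mul (by positivity), Real.mul_rpow hs.le hL0.le,
        ← Real.rpow_add hL0]
      congr 2 <;> ring
    have hI : (∫ y : ℝ, hFun α y w ^ 2 / fFun α y w) =
        2 * (α * w ^ α) ^ 2 * ∫ y in Ioi (0:ℝ), HH α w y ^ 2 / fFun α y w := by
      have h3 := integral_comp_abs (f := fun y => hFun α y w ^ 2 / fFun α y w)
      simp only [hFun_abs h0 _ w hw, fFun_abs h0 _ w hw] at h3
      rw [h3, mul_assoc, ← integral_const_mul ((α * w ^ α) ^ 2)]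
      congr 2
      funext y
      have : 0 < w ^ α := by positivity
      rw [HH]; field_simp
    have hpt : 0 < w ^ α := by positivity
    set J := ∫ y in Ioi (0:ℝ), HH α w y ^ 2 / fFun α y w with hJ
    have hmain : α ^ 2 * kappa0 σ δ α / (X * L ^ (α / 2)) =
        2 * (α * w ^ α) ^ 2 * (cc0 α * (w ^ α)⁻¹ * (M ^ (-α) / α)) := by
      rw [kappa0, cAlpha_eq hα, ← hκdef, hMa, Real.rpow_neg hs.le, Real.rpow_neg hL0.le]
      have : 0 < (2 - α) ^ (α / 2) := by positivity
      have : 0 < L ^ (α / 2) := by positivity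
      have e : 2 * (α * w ^ α) ^ 2 * (cc0 α * (w ^ α)⁻¹ * (((2 - α) ^ (α / 2))⁻¹ * (L ^ (α / 2))⁻¹ / α)) =
        2 * α * w ^ α * (cc0 α * (((2 - α) ^ (α / 2))⁻¹ * (L ^ (α / 2))⁻¹)) := by
        field_simp
      rw [e, hwt]
      field_simp
    have hfin : L ^ (-(1 / 2 : ℝ)) ≤ Real.log L / L ^ (min (1 / 4 : ℝ) α) := by
      have a1 : 1 ≤ Real.log L := by
        rw [Real.le_log_iff_exp_le hL0]; exact hL
      have a2 : L ^ (min (1 / 4 : ℝ) α) ≤ L ^ (1 / 2 : ℝ) :=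
        Real.rpow_le_rpow_of_exponent_le hL1 ((min_le_left _ _).trans (by norm_num))
      rw [Real.rpow_neg hL0.le, ← one_div]
      have : 0 < L ^ (min (1 / 4 : ℝ) α) := by positivity
      gcongr
    rw [hI, hmain, ← mul_sub, abs_mul, abs_of_pos (a := 2 * (α * w ^ α) ^ 2) (by positivity)]
    calc _ ≤ 2 * (α * w ^ α) ^ 2 * (C * ((w ^ α)⁻¹ * M ^ (-(1 + α)))) := by gcongr
      _ = 2 * α ^ 2 * C * w ^ α * M ^ (-(1 + α)) := by field_simp
      _ = D * (1 / (X * L ^ (α / 2))) * L ^ (-(1 / 2 : ℝ)) := by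
        rw [hwt, hMb, hD, Real.rpow_neg hL0.le (α / 2)]; field_simp
      _ ≤ _ := by gcongr
  obtain ⟨N, hN⟩ := eventually_atTop.mp hall
  exact ⟨D, hD0, N, fun n hn => hN n hn⟩

end LevyLAN
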